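/- arXiv:2001.08778 — 7 statements merged into one kernel-verified Lean document; each statement's English description precedes it below -/
import Mathlib

section
/- Let a > 0 and let g be holomorphic on the strip S_a = {τ ∈ ℂ : 0 < Im τ < a}. Suppose g satisfies the slow-growth condition: there exist C > 0 and nonnegative integers N, M such that |g(x+iy)| ≤ C(1+|x|^N) y^{-M} for all x ∈ ℝ and y ∈ (0,a). Then for every Schwartz function f : ℝ → ℂ the limit lim_{y→0+} ∫_ℝ g(x+iy) f(x) dx exists and is finite, and the map sending f to this limit is a tempered distribution, i.e. a continuous linear functional on the Schwartz space S(ℝ). -/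
open MeasureTheory Filter Complex

/-- A power bound `‖F'(t)‖ ≤ K t ^ (-s)` integrates to a bound on the increments of `F`. -/
lemma norm_sub_le_of_deriv_rpow_bound {F F' : ℝ → ℂ} {b K s : ℝ} (hs : s ≠ 1)
    (hF : ∀ t, 0 < t → t ≤ b → HasDerivAt F (F' t) t)
    (hK : ∀ t, 0 < t → t ≤ b → ‖F' t‖ ≤ K * t ^ (-s))
    {y t : ℝ} (hy : 0 < y) (hyt : y ≤ t) (ht : t ≤ b) :
    ‖F t - F y‖ ≤ K / (1 - s) * (t ^ (1 - s) - y ^ (1 - s)) := by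
  have hs' : 1 - s ≠ 0 := sub_ne_zero.2 hs.symm
  have hd : ∀ u, 0 < u → HasDerivAt
      (fun u : ℝ => K / (1 - s) * (u ^ (1 - s) - y ^ (1 - s))) (K * u ^ (-s)) u := by
    intro u hu
    have h := ((Real.hasDerivAt_rpow_const (p := 1 - s) (Or.inl hu.ne')).sub_const
      (y ^ (1 - s))).const_mul (K / (1 - s))
    rw [show 1 - s - 1 = -s by ring, ← mul_assoc, div_mul_cancel₀ _ hs'] at h
    exact h
  refine image_norm_le_of_norm_deriv_right_le_deriv_boundary' (f := fun u => F u - F y)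
    (f' := F') (a := y) (b := t) (B' := fun u => K * u ^ (-s))
    (B := fun u : ℝ => K / (1 - s) * (u ^ (1 - s) - y ^ (1 - s)))
    ?_ ?_ (by simp) ?_ ?_ ?_ ⟨hyt, le_rfl⟩
  · exact fun u hu => ((hF u (hy.trans_le hu.1) (hu.2.trans ht)).sub_const
      (F y)).continuousAt.continuousWithinAt
  · exact fun u hu => ((hF u (hy.trans_le hu.1) (hu.2.le.trans ht)).sub_const
      (F y)).hasDerivWithinAt
  · exact fun u hu => (hd u (hy.trans_le hu.1)).continuousAt.continuousWithinAt
  · exact fun u hu => (hd u (hy.trans_le hu.1)).hasDerivWithinAt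
  · exact fun u hu => hK u (hy.trans_le hu.1) (hu.2.le.trans ht)

section AbstractBoundaryValue

variable {E : Type*} [AddCommGroup E] [Module ℂ E] [TopologicalSpace E]
  {F : ℝ → E → ℂ} {D : E →L[ℂ] E} {b : ℝ}

/-- If `∂_y F_y(f) = F_y(D f)`, a growth bound `y ^ (-(m + 1/2))` as `y → 0+`, locally uniform
in `f`, improves to `y ^ (-1/2)`. -/
lemma exists_rpow_neg_half_bound (hb : 0 < b) (hb1 : b ≤ 1)
    (hF : ∀ f t, 0 < t → t ≤ b → HasDerivAt (F · f) (F t (D f)) t) (m : ℕ)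
    (h : ∃ q : E → ℝ, Continuous q ∧ q 0 = 0 ∧
      ∀ f t, 0 < t → t ≤ b → ‖F t f‖ ≤ q f * t ^ (-((m : ℝ) + 1 / 2))) :
    ∃ q : E → ℝ, Continuous q ∧ q 0 = 0 ∧
      ∀ f t, 0 < t → t ≤ b → ‖F t f‖ ≤ q f * t ^ (-(1 / 2 : ℝ)) := by
  induction m with
  | zero => simpa using h
  | succ m ih =>
    obtain ⟨q, hqc, hq0, hq⟩ := h
    refine ih ⟨fun f => q f * b ^ (-((m : ℝ) + 1 + 1 / 2)) + q (D f) / (m + 1 / 2), ?_, ?_, ?_⟩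
    · exact (hqc.mul_const _).add ((hqc.comp D.continuous).div_const _)
    · simp [hq0]
    intro f t ht htb
    push_cast at hq
    have hm : (0 : ℝ) < m + 1 / 2 := by positivity
    have hnonneg : ∀ f, 0 ≤ q f := fun f =>
      nonneg_of_mul_nonneg_left ((norm_nonneg _).trans (hq f b hb le_rfl))
        (Real.rpow_pos_of_pos hb _)
    have h1 := norm_sub_le_of_deriv_rpow_bound (s := (m : ℝ) + 1 + 1 / 2) (by linarith)
      (hF f) (hq (D f)) ht htb le_rfl
    have hexp : 1 - ((m : ℝ) + 1 + 1 / 2) = -((m : ℝ) + 1 / 2) := by ring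
    rw [hexp, div_neg, neg_mul, ← mul_neg, neg_sub] at h1
    have h2 := hq f b hb le_rfl
    have h3 : ‖F t f‖ ≤ ‖F b f‖ + ‖F b f - F t f‖ := by
      have := norm_sub_le (F b f) (F b f - F t f)
      simpa using this
    have h4 : 1 ≤ t ^ (-((m : ℝ) + 1 / 2)) :=
      Real.one_le_rpow_of_pos_of_le_one_of_nonpos ht (htb.trans hb1) (by linarith)
    have h5 : 0 ≤ q (D f) / (m + 1 / 2) := div_nonneg (hnonneg _) hm.le
    have h6 : 0 < b ^ (-((m : ℝ) + 1 / 2)) := Real.rpow_pos_of_pos hb _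
    have h7 : 0 ≤ q f * b ^ (-((m : ℝ) + 1 + 1 / 2)) :=
      mul_nonneg (hnonneg f) (Real.rpow_pos_of_pos hb _).le
    nlinarith [mul_le_mul_of_nonneg_left h4 h7, mul_nonneg h5 h6.le]

/-- A family of functionals on `E`, linear for small `y > 0`, with `∂_y F_y(f) = F_y(D f)` and at
most polynomial growth as `y → 0+`, converges pointwise to a continuous linear functional. -/
lemma exists_clm_tendsto_of_hasDerivAt_of_rpow_bound [IsTopologicalAddGroup E]
    (hb : 0 < b) (hb1 : b ≤ 1)
    (hadd : ∀ t, 0 < t → t ≤ b → ∀ f g, F t (f + g) = F t f + F t g)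
    (hsmul : ∀ t, 0 < t → t ≤ b → ∀ (c : ℂ) f, F t (c • f) = c * F t f)
    (hF : ∀ f t, 0 < t → t ≤ b → HasDerivAt (F · f) (F t (D f)) t) (m : ℕ)
    (h : ∃ q : E → ℝ, Continuous q ∧ q 0 = 0 ∧
      ∀ f t, 0 < t → t ≤ b → ‖F t f‖ ≤ q f * t ^ (-((m : ℝ) + 1 / 2))) :
    ∃ T : E →L[ℂ] ℂ, ∀ f, Tendsto (F · f) (nhdsWithin 0 (Set.Ioi 0)) (nhds (T f)) := by
  obtain ⟨q, hqc, hq0, hq⟩ := exists_rpow_neg_half_bound hb hb1 hF m h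
  have hev : ∀ᶠ t in nhdsWithin (0 : ℝ) (Set.Ioi 0), 0 < t ∧ t ≤ b := by
    filter_upwards [Ioc_mem_nhdsGT hb] with t ht using ht
  have hnonneg : ∀ f, 0 ≤ q f := fun f =>
    nonneg_of_mul_nonneg_left ((norm_nonneg _).trans (hq f b hb le_rfl))
      (Real.rpow_pos_of_pos hb _)
  have hinc : ∀ f y t, 0 < y → y ≤ t → t ≤ b →
      ‖F t f - F y f‖ ≤ 2 * q (D f) * (t ^ (1 / 2 : ℝ) - y ^ (1 / 2 : ℝ)) := by
    intro f y t hy hyt ht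
    have := norm_sub_le_of_deriv_rpow_bound (s := 1 / 2) (by norm_num)
      (hF f) (hq (D f)) hy hyt ht
    rw [show (1 : ℝ) - 1 / 2 = 1 / 2 by norm_num] at this
    linarith
  have hrpow : Tendsto (fun t : ℝ => t ^ (1 / 2 : ℝ)) (nhdsWithin 0 (Set.Ioi 0)) (nhds 0) := by
    have := (Real.continuous_rpow_const (q := 1 / 2) (by norm_num)).tendsto (0 : ℝ)
    rw [Real.zero_rpow (by norm_num)] at this
    exact this.mono_left nhdsWithin_le_nhds
  have hlim : ∀ f, ∃ L, Tendsto (F · f) (nhdsWithin 0 (Set.Ioi 0)) (nhds L) := by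
    intro f
    rw [← cauchy_map_iff_exists_tendsto, cauchy_map_iff', tendsto_uniformity_iff_dist_tendsto_zero]
    have hz : Tendsto (fun p : ℝ × ℝ => 2 * q (D f) * |p.1 ^ (1 / 2 : ℝ) - p.2 ^ (1 / 2 : ℝ)|)
        (nhdsWithin 0 (Set.Ioi 0) ×ˢ nhdsWithin 0 (Set.Ioi 0)) (nhds 0) := by
      have := (((hrpow.comp tendsto_fst).sub (hrpow.comp tendsto_snd)).abs).const_mul
        (2 * q (D f))
      simpa using this
    refine squeeze_zero' (Eventually.of_forall fun _ => dist_nonneg) ?_ hz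
    filter_upwards [hev.prod_mk hev] with p hp
    rw [dist_eq_norm]
    rcases le_total p.1 p.2 with hle | hle
    · rw [norm_sub_rev, abs_sub_comm]
      exact (hinc f _ _ hp.1.1 hle hp.2.2).trans
        (mul_le_mul_of_nonneg_left (le_abs_self _) (by linarith [hnonneg (D f)]))
    · exact (hinc f _ _ hp.2.1 hle hp.1.2).trans
        (mul_le_mul_of_nonneg_left (le_abs_self _) (by linarith [hnonneg (D f)]))
  choose L hL using hlim
  let T : E →ₗ[ℂ] ℂ :=
    { toFun := L
      map_add' := fun f g => tendsto_nhds_unique (hL (f + g))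
        (((hL f).add (hL g)).congr' (hev.mono fun t ht => (hadd t ht.1 ht.2 f g).symm))
      map_smul' := fun c f => tendsto_nhds_unique (hL (c • f))
        (((hL f).const_mul c).congr' (hev.mono fun t ht => (hsmul t ht.1 ht.2 c f).symm)) }
  have hTb : ∀ f, ‖T f‖ ≤ q f * b ^ (-(1 / 2 : ℝ)) + 2 * q (D f) * b ^ (1 / 2 : ℝ) := by
    intro f
    refine le_of_tendsto (hL f).norm (hev.mono fun t ht => ?_)
    have h3 : ‖F t f‖ ≤ ‖F b f‖ + ‖F b f - F t f‖ := by
      have := norm_sub_le (F b f) (F b f - F t f)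
      simpa using this
    nlinarith [hinc f t b ht.1 ht.2 le_rfl, hq f b hb le_rfl,
      mul_nonneg (hnonneg (D f)) (Real.rpow_nonneg ht.1.le (1 / 2))]
  refine ⟨⟨T, ?_⟩, hL⟩
  refine continuous_of_continuousAt_zero T ?_
  rw [ContinuousAt, map_zero, tendsto_zero_iff_norm_tendsto_zero]
  have hcont : Continuous fun f => q f * b ^ (-(1 / 2 : ℝ)) + 2 * q (D f) * b ^ (1 / 2 : ℝ) :=
    (hqc.mul_const _).add (((hqc.comp D.continuous).const_mul 2).mul_const _)
  have h0 := hcont.tendsto 0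
  simp only [map_zero, hq0, zero_mul, mul_zero, add_zero] at h0
  exact squeeze_zero (fun _ => norm_nonneg _) hTb h0

end AbstractBoundaryValue

/-- Integrating Schwartz functions against continuous functions of growth `K (1 + |x|) ^ N` is
bounded by `K` times a seminorm-like gauge depending only on `N`. -/
lemma SchwartzMap.exists_gauge_integral_mul (N : ℕ) :
    ∃ p : SchwartzMap ℝ ℂ → ℝ, Continuous p ∧ p 0 = 0 ∧
      ∀ (f : SchwartzMap ℝ ℂ) (h : ℝ → ℂ) (K : ℝ), Continuous h →
        (∀ x, ‖h x‖ ≤ K * (1 + |x|) ^ N) →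
        Integrable (fun x => h x * f x) ∧ ‖∫ x, h x * f x‖ ≤ K * p f := by
  set σ : Seminorm ℂ (SchwartzMap ℝ ℂ) :=
    (Finset.Iic (N + 2, 0)).sup (fun m => SchwartzMap.seminorm ℂ m.1 m.2) with hσ
  have hJ : Integrable (fun x : ℝ => (1 + ‖x‖) ^ (-(2 : ℝ))) :=
    integrable_one_add_norm (by simp)
  have hσc : Continuous σ := Seminorm.continuous_finsetSup fun i _ =>
    (schwartz_withSeminorms ℂ ℝ ℂ).continuous_seminorm i
  refine ⟨fun f => 2 ^ (N + 2) * σ f * ∫ x : ℝ, (1 + ‖x‖) ^ (-(2 : ℝ)),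
    (hσc.const_mul _).mul_const _, by simp, fun f h K hc hK => ?_⟩
  have hpt : ∀ x, ‖h x * f x‖ ≤ K * (2 ^ (N + 2) * σ f) * (1 + ‖x‖) ^ (-(2 : ℝ)) := by
    intro x
    have hpos : 0 < 1 + ‖x‖ := by positivity
    have h1 := SchwartzMap.one_add_le_sup_seminorm_apply (𝕜 := ℂ) (m := (N + 2, 0))
      (k := N + 2) (n := 0) le_rfl le_rfl f x
    rw [norm_iteratedFDeriv_zero, ← hσ] at h1
    have hK0 : 0 ≤ K := by simpa using (norm_nonneg _).trans (hK 0)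
    rw [norm_mul, Real.rpow_neg hpos.le, Real.rpow_two, ← div_eq_mul_inv,
      le_div_iff₀ (by positivity)]
    calc ‖h x‖ * ‖f x‖ * (1 + ‖x‖) ^ 2
        ≤ (K * (1 + ‖x‖) ^ N) * ‖f x‖ * (1 + ‖x‖) ^ 2 := by
          gcongr
          exact hK x
      _ = K * ((1 + ‖x‖) ^ (N + 2) * ‖f x‖) := by ring
      _ ≤ K * (2 ^ (N + 2) * σ f) := by gcongr
  have hJ' := hJ.const_mul (K * (2 ^ (N + 2) * σ f))
  refine ⟨hJ'.mono' (hc.mul f.continuous).aestronglyMeasurable (Eventually.of_forall hpt), ?_⟩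
  refine (norm_integral_le_of_norm_le hJ' (Eventually.of_forall hpt)).trans_eq ?_
  rw [integral_const_mul]
  ring

lemma isOpen_im_strip (a : ℝ) : IsOpen {τ : ℂ | 0 < τ.im ∧ τ.im < a} :=
  (isOpen_lt continuous_const continuous_im).inter (isOpen_lt continuous_im continuous_const)

section Strip

variable {a : ℝ} {g : ℂ → ℂ} (hg : DifferentiableOn ℂ g {τ : ℂ | 0 < τ.im ∧ τ.im < a})

include hg

lemma hasDerivAt_of_differentiableOn_strip {x y : ℝ} (hy : 0 < y) (hya : y < a) :
    HasDerivAt g (deriv g (x + y * I)) (x + y * I) :=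
  (hg.differentiableAt ((isOpen_im_strip a).mem_nhds (by simp [hy, hya]))).hasDerivAt

lemma continuous_horizontal {y : ℝ} (hy : 0 < y) (hya : y < a) :
    Continuous fun x : ℝ => g (x + y * I) :=
  hg.continuousOn.comp_continuous (by fun_prop) fun x => by simp [hy, hya]

lemma continuous_deriv_horizontal {y : ℝ} (hy : 0 < y) (hya : y < a) :
    Continuous fun x : ℝ => deriv g (x + y * I) :=
  (hg.deriv (isOpen_im_strip a)).continuousOn.comp_continuous (by fun_prop)
    fun x => by simp [hy, hya]

/-- Cauchy's estimate: slow growth of `g` passes to `deriv g`, locally uniformly in `Im τ`. -/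
lemma exists_deriv_bound_near {C : ℝ} (hC : 0 < C) {N M : ℕ}
    (hbound : ∀ x y : ℝ, 0 < y → y < a → ‖g (x + y * I)‖ ≤ C * (1 + |x|) ^ N / y ^ M)
    {y₀ : ℝ} (hy₀ : 0 < y₀) (hy₀a : y₀ ≤ a / 2) :
    ∃ K, ∀ x y : ℝ, y ∈ Metric.ball y₀ (y₀ / 4) →
      ‖deriv g (x + y * I)‖ ≤ K * (1 + |x|) ^ N := by
  refine ⟨C * (1 + y₀) ^ N / (y₀ / 2) ^ M / (y₀ / 4), fun x y hy => ?_⟩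
  rw [Metric.mem_ball, Real.dist_eq, abs_lt] at hy
  have him : ∀ z ∈ Metric.closedBall (x + y * I : ℂ) (y₀ / 4),
      y₀ / 2 < z.im ∧ z.im < a ∧ |z.re| ≤ |x| + y₀ := by
    intro z hz
    rw [Metric.mem_closedBall, dist_eq_norm] at hz
    have h1 := abs_le.1 ((abs_im_le_norm _).trans hz)
    have h2 := (abs_re_le_norm _).trans hz
    rw [show (z - (x + y * I)).im = z.im - y by simp] at h1
    rw [show (z - (x + y * I)).re = z.re - x by simp] at h2
    have h3 := abs_sub_abs_le_abs_sub z.re x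
    exact ⟨by linarith, by linarith, by linarith⟩
  have key := norm_deriv_le_of_forall_mem_sphere_norm_le (f := g) (c := (x + y * I : ℂ))
    (R := y₀ / 4) (C := C * (1 + y₀) ^ N / (y₀ / 2) ^ M * (1 + |x|) ^ N) (by linarith) ?_ ?_
  · refine key.trans_eq ?_
    ring
  · refine DifferentiableOn.diffContOnCl ?_
    rw [closure_ball _ (by linarith)]
    exact hg.mono fun z hz => ⟨by linarith [(him z hz).1], (him z hz).2.1⟩
  · intro z hz
    obtain ⟨h1, h2, h3⟩ := him z (Metric.sphere_subset_closedBall hz)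
    have h4 := hbound z.re z.im (by linarith) h2
    rw [re_add_im] at h4
    refine h4.trans ?_
    have h5 : 1 + |z.re| ≤ (1 + y₀) * (1 + |x|) := by nlinarith [abs_nonneg x]
    calc C * (1 + |z.re|) ^ N / z.im ^ M
        ≤ C * ((1 + y₀) * (1 + |x|)) ^ N / (y₀ / 2) ^ M := by gcongr
      _ = _ := by rw [mul_pow]; ring

/-- Differentiation in `y` of the horizontal pairings falls on the test function. -/
lemma hasDerivAt_integral_horizontal {C : ℝ} (hC : 0 < C) {N M : ℕ}
    (hbound : ∀ x y : ℝ, 0 < y → y < a → ‖g (x + y * I)‖ ≤ C * (1 + |x|) ^ N / y ^ M)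
    (f : SchwartzMap ℝ ℂ) {y₀ : ℝ} (hy₀ : 0 < y₀) (hy₀a : y₀ ≤ a / 2) :
    HasDerivAt (fun y : ℝ => ∫ x : ℝ, g (x + y * I) * f x)
      (∫ x : ℝ, g (x + y₀ * I) * ((-I) • SchwartzMap.derivCLM ℂ ℂ f) x) y₀ := by
  obtain ⟨p, -, -, hp⟩ := SchwartzMap.exists_gauge_integral_mul N
  obtain ⟨K, hK⟩ := exists_deriv_bound_near hg hC hbound hy₀ hy₀a
  have hya : y₀ < a := by linarith
  have hball : ∀ y ∈ Metric.ball y₀ (y₀ / 4), 0 < y ∧ y < a := by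
    intro y hy
    rw [Metric.mem_ball, Real.dist_eq, abs_lt] at hy
    exact ⟨by linarith, by linarith⟩
  have hmem : y₀ ∈ Metric.ball y₀ (y₀ / 4) := Metric.mem_ball_self (by linarith)
  have hint : ∀ f : SchwartzMap ℝ ℂ, Integrable fun x : ℝ => g (x + y₀ * I) * f x := fun f =>
    (hp f _ (C / y₀ ^ M) (continuous_horizontal hg hy₀ hya) fun x =>
      (hbound x y₀ hy₀ hya).trans_eq (by ring)).1
  have hint' : Integrable fun x : ℝ => deriv g (x + y₀ * I) * f x :=
    (hp f _ K (continuous_deriv_horizontal hg hy₀ hya) fun x => hK x y₀ hmem).1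
  have hdom : Integrable fun x : ℝ => K * (1 + |x|) ^ N * ‖f x‖ := by
    have h := (hp f (fun x => ((K * (1 + |x|) ^ N : ℝ) : ℂ)) |K| (by fun_prop) fun x => by
      rw [norm_real, norm_mul, Real.norm_eq_abs, Real.norm_of_nonneg (by positivity)]).1.norm
    have hK0 : 0 ≤ K := by
      have := (norm_nonneg _).trans (hK 0 y₀ hmem)
      simpa using this
    refine h.congr (Eventually.of_forall fun x => ?_)
    simp only [norm_mul, norm_real]
    rw [← norm_mul, Real.norm_of_nonneg (by positivity)]
  have hparts := integral_mul_deriv_eq_deriv_mul_of_integrable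
    (u := fun x : ℝ => g (x + y₀ * I)) (u' := fun x : ℝ => deriv g (x + y₀ * I))
    (v := f) (v' := SchwartzMap.derivCLM ℂ ℂ f)
    (fun x _ => ((hasDerivAt_of_differentiableOn_strip hg hy₀ hya).comp_add_const
      (x : ℂ) (y₀ * I)).comp_ofReal)
    (fun x _ => f.hasDerivAt x) (hint (SchwartzMap.derivCLM ℂ ℂ f)) hint' (hint f)
  have hmain := (hasDerivAt_integral_of_dominated_loc_of_deriv_le (μ := volume)
    (F := fun (y x : ℝ) => g (x + y * I) * f x)
    (F' := fun (y x : ℝ) => deriv g (x + y * I) * I * f x)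
    (bound := fun x : ℝ => K * (1 + |x|) ^ N * ‖f x‖) (x₀ := y₀)
    (Metric.ball_mem_nhds y₀ (by linarith : 0 < y₀ / 4)) ?_ (hint f) ?_ ?_ hdom ?_).2
  · refine hmain.congr_deriv (Eq.symm ?_)
    simp only [_root_.smul_apply, smul_eq_mul]
    calc ∫ x : ℝ, g (x + y₀ * I) * (-I * SchwartzMap.derivCLM ℂ ℂ f x)
        = ∫ x : ℝ, -I * (g (x + y₀ * I) * SchwartzMap.derivCLM ℂ ℂ f x) := by
          congr with x; ring
      _ = I * ∫ x : ℝ, deriv g (x + y₀ * I) * f x := by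
          rw [integral_const_mul, hparts]; ring
      _ = ∫ x : ℝ, deriv g (x + y₀ * I) * I * f x := by
          rw [← integral_const_mul]; congr with x; ring
  · filter_upwards [Metric.ball_mem_nhds y₀ (by linarith : 0 < y₀ / 4)] with y hy
    exact ((continuous_horizontal hg (hball y hy).1 (hball y hy).2).mul
      f.continuous).aestronglyMeasurable
  · exact (((continuous_deriv_horizontal hg hy₀ hya).mul_const I).mul
      f.continuous).aestronglyMeasurable
  · refine Eventually.of_forall fun x y hy => ?_
    rw [norm_mul, norm_mul, norm_I, mul_one]
    gcongr
    exact hK x y hy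
  · refine Eventually.of_forall fun x y hy => HasDerivAt.mul_const ?_ (f x)
    have hline : HasDerivAt (fun y : ℝ => (x + y * I : ℂ)) I y := by
      simpa using ((hasDerivAt_id y).ofReal_comp.mul_const I).const_add (x : ℂ)
    exact (hasDerivAt_of_differentiableOn_strip hg (hball y hy).1 (hball y hy).2).comp y hline

end Strip

/-- **Vladimirov boundary value theorem, existence part.**
If `g` is holomorphic on the strip `0 < Im τ < a` and satisfies the slow-growth condition
`|g(x+iy)| ≤ C (1+|x|^N) y^{-M}`, then for every Schwartz function `f` the limit
`lim_{y→0+} ∫ g(x+iy) f(x) dx` exists, and `f ↦ lim` is a tempered distribution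
(a continuous linear functional on Schwartz space). -/
theorem boundary_value_exists_and_is_tempered_distribution
    (a : ℝ) (ha : 0 < a)
    (g : ℂ → ℂ)
    (hg : DifferentiableOn ℂ g {τ : ℂ | 0 < τ.im ∧ τ.im < a})
    (C : ℝ) (hC : 0 < C) (N M : ℕ)
    (hbound : ∀ x y : ℝ, 0 < y → y < a →
      ‖g (↑x + ↑y * Complex.I)‖ ≤ C * (1 + |x| ^ N) / y ^ M) :
    ∃ T : SchwartzMap ℝ ℂ →L[ℂ] ℂ,
      ∀ f : SchwartzMap ℝ ℂ,
        Tendsto (fun y : ℝ => ∫ x : ℝ, g (↑x + ↑y * Complex.I) * f x)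
          (nhdsWithin 0 (Set.Ioi 0)) (nhds (T f)) := by
  have hbound' : ∀ x y : ℝ, 0 < y → y < a →
      ‖g (x + y * I)‖ ≤ 2 * C * (1 + |x|) ^ N / y ^ M := by
    intro x y hy hya
    refine (hbound x y hy hya).trans ?_
    have h1 : (1 : ℝ) ≤ (1 + |x|) ^ N := one_le_pow₀ (by linarith [abs_nonneg x])
    have h2 : |x| ^ N ≤ (1 + |x|) ^ N := by gcongr; linarith
    have h3 : C * (1 + |x| ^ N) ≤ 2 * C * (1 + |x|) ^ N := by nlinarith
    gcongr
  obtain ⟨p, hpc, hp0, hp⟩ := SchwartzMap.exists_gauge_integral_mul N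
  set b : ℝ := min (a / 2) 1
  have hb : 0 < b := lt_min (by linarith) one_pos
  have hba : b ≤ a / 2 := min_le_left _ _
  have hb1 : b ≤ 1 := min_le_right _ _
  have hpair : ∀ (f : SchwartzMap ℝ ℂ) (t : ℝ), 0 < t → t ≤ b →
      Integrable (fun x : ℝ => g (x + t * I) * f x) ∧
        ‖∫ x : ℝ, g (x + t * I) * f x‖ ≤ 2 * C / t ^ M * p f := fun f t ht htb =>
    hp f _ _ (continuous_horizontal hg ht (by linarith)) fun x =>
      (hbound' x t ht (by linarith)).trans_eq (by ring)
  refine exists_clm_tendsto_of_hasDerivAt_of_rpow_bound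
    (F := fun (y : ℝ) (f : SchwartzMap ℝ ℂ) => ∫ x : ℝ, g (x + y * I) * f x)
    (D := (-I) • SchwartzMap.derivCLM ℂ ℂ) hb hb1 ?_ ?_ ?_ M
    ⟨fun f => 2 * C * p f, hpc.const_mul _, by simp [hp0], ?_⟩
  · intro t ht htb f h
    rw [← integral_add (hpair f t ht htb).1 (hpair h t ht htb).1]
    simp only [_root_.add_apply, mul_add]
  · intro t _ _ c f
    rw [← integral_const_mul]
    simp only [_root_.smul_apply, smul_eq_mul, mul_left_comm]
  · exact fun f t ht htb => hasDerivAt_integral_horizontal hg (by positivity) hbound' f ht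
      (htb.trans hba)
  · intro f t ht htb
    obtain ⟨-, h⟩ := hpair f t ht htb
    have hpow : (t ^ M)⁻¹ ≤ t ^ (-((M : ℝ) + 1 / 2)) := by
      rw [← Real.rpow_natCast, ← Real.rpow_neg ht.le]
      exact Real.rpow_le_rpow_of_exponent_ge ht (htb.trans hb1) (by linarith)
    have hnn : 0 ≤ 2 * C * p f := by
      have hpos : 0 < 2 * C / t ^ M := by positivity
      have := nonneg_of_mul_nonneg_right ((norm_nonneg _).trans h) hpos
      positivity
    calc _ ≤ 2 * C * p f * (t ^ M)⁻¹ := h.trans_eq (by ring)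
      _ ≤ _ := mul_le_mul_of_nonneg_left hpow hnn
end

section
/- Let a > 0, C > 0 and let M be a nonnegative integer. Let F : (0,a) → ℂ be (M+2)-times differentiable and suppose that |F^{(M+2)}(y)| ≤ C y^{-M} for all y ∈ (0,a). Then the limit lim_{y→0+} F(y) exists and is finite; moreover F' is bounded on (0, a/2). -/
open Filter

section PowerBounds

variable {E : Type*} [NormedAddCommGroup E] [NormedSpace ℝ E]

/-- Integrating `‖g'(x)‖ ≤ K x ^ (-s)` from `y` to `b`, where `s ≠ 1`. -/
lemma norm_le_of_hasDerivAt_norm_le_rpow {g g' : ℝ → E} {b K s : ℝ} (hs : s ≠ 1)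
    (hg : ∀ x ∈ Set.Ioc 0 b, HasDerivAt g (g' x) x)
    (hbd : ∀ x ∈ Set.Ioc 0 b, ‖g' x‖ ≤ K * x ^ (-s)) {y : ℝ} (hy : y ∈ Set.Ioc 0 b) :
    ‖g y‖ ≤ ‖g b‖ + K * ((b ^ (1 - s) - y ^ (1 - s)) / (1 - s)) := by
  have hs' : 1 - s ≠ 0 := sub_ne_zero.mpr hs.symm
  have hB : ∀ x ∈ Set.Icc y b, HasDerivAt
      (fun x : ℝ => K * ((x ^ (1 - s) - y ^ (1 - s)) / (1 - s))) (K * x ^ (-s)) x := by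
    intro x hx
    have hx0 : x ≠ 0 := (hy.1.trans_le hx.1).ne'
    refine ((((Real.hasDerivAt_rpow_const (p := 1 - s) (Or.inl hx0)).sub_const
      (y ^ (1 - s))).div_const (1 - s)).const_mul K).congr_deriv ?_
    rw [mul_div_cancel_left₀ _ hs', sub_sub_cancel_left]
  have hgd : ∀ x ∈ Set.Icc y b, HasDerivAt (fun x => g x - g y) (g' x) x := fun x hx =>
    (hg x ⟨hy.1.trans_le hx.1, hx.2⟩).sub_const _
  have key := image_norm_le_of_norm_deriv_right_le_deriv_boundary'
    (fun x hx => (hgd x hx).continuousAt.continuousWithinAt)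
    (fun x hx => (hgd x ⟨hx.1, hx.2.le⟩).hasDerivWithinAt)
    (by simp)
    (fun x hx => (hB x hx).continuousAt.continuousWithinAt)
    (fun x hx => (hB x ⟨hx.1, hx.2.le⟩).hasDerivWithinAt)
    (fun x hx => hbd x ⟨hy.1.trans_le hx.1, hx.2.le⟩) (Set.right_mem_Icc.mpr hy.2)
  have := norm_sub_norm_le (g y) (g b)
  rw [norm_sub_rev] at this
  linarith

lemma exists_norm_le_rpow_of_one_lt {g g' : ℝ → E} {b K s : ℝ} (hs : 1 < s) (hK : 0 ≤ K)
    (hg : ∀ x ∈ Set.Ioc 0 b, HasDerivAt g (g' x) x)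
    (hbd : ∀ x ∈ Set.Ioc 0 b, ‖g' x‖ ≤ K * x ^ (-s)) :
    ∃ K', 0 ≤ K' ∧ ∀ y ∈ Set.Ioc 0 b, ‖g y‖ ≤ K' * y ^ (1 - s) := by
  have hs' : 0 < s - 1 := sub_pos.mpr hs
  by_cases hb : 0 < b
  swap
  · exact ⟨0, le_rfl, fun y hy => absurd (hy.1.trans_le hy.2) hb⟩
  refine ⟨‖g b‖ * b ^ (s - 1) + K / (s - 1), by positivity, fun y hy => ?_⟩
  refine (norm_le_of_hasDerivAt_norm_le_rpow hs.ne' hg hbd hy).trans ?_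
  rw [add_mul]
  have hpow : b ^ (1 - s) ≤ y ^ (1 - s) :=
    Real.rpow_le_rpow_of_nonpos hy.1 hy.2 (by linarith)
  have hone : b ^ (s - 1) * b ^ (1 - s) = 1 := by
    rw [← Real.rpow_add hb]; simp
  have hbs : 0 ≤ b ^ (1 - s) := by positivity
  gcongr ?_ + ?_
  · rw [mul_assoc]
    refine le_mul_of_one_le_right (norm_nonneg _) ?_
    exact hone.ge.trans (by gcongr)
  · rw [div_mul_eq_mul_div, mul_div_assoc]
    gcongr K * ?_
    rw [← neg_div_neg_eq]
    simp only [neg_sub]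
    gcongr
    linarith

lemma exists_norm_le_of_lt_one {g g' : ℝ → E} {b K s : ℝ} (hs : s < 1) (hK : 0 ≤ K)
    (hg : ∀ x ∈ Set.Ioc 0 b, HasDerivAt g (g' x) x)
    (hbd : ∀ x ∈ Set.Ioc 0 b, ‖g' x‖ ≤ K * x ^ (-s)) :
    ∃ B, ∀ y ∈ Set.Ioc 0 b, ‖g y‖ ≤ B := by
  have hs' : 0 < 1 - s := sub_pos.mpr hs
  refine ⟨‖g b‖ + K * (b ^ (1 - s) / (1 - s)), fun y hy => ?_⟩
  refine (norm_le_of_hasDerivAt_norm_le_rpow hs.ne hg hbd hy).trans ?_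
  have : 0 ≤ y ^ (1 - s) := Real.rpow_nonneg hy.1.le _
  gcongr
  linarith

end PowerBounds

/-- **The Newton–Leibniz bootstrap lemma.**
If `F : (0,a) → ℂ` is `(M+2)`-times differentiable with `|F^{(M+2)}(y)| ≤ C y^{-M}`,
then `lim_{y→0+} F(y)` exists and is finite, and `F'` is bounded on `(0, a/2)`. -/
theorem limit_exists_of_derivative_bound
    (a : ℝ) (ha : 0 < a) (C : ℝ) (hC : 0 < C) (M : ℕ)
    (F : ℝ → ℂ)
    (hdiff : ∀ j < M + 2,
      DifferentiableOn ℝ (iteratedDerivWithin j F (Set.Ioo 0 a)) (Set.Ioo 0 a))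
    (hbound : ∀ y ∈ Set.Ioo 0 a,
      ‖iteratedDerivWithin (M + 2) F (Set.Ioo 0 a) y‖ ≤ C / y ^ M) :
    (∃ Lim : ℂ, Tendsto F (nhdsWithin 0 (Set.Ioi 0)) (nhds Lim)) ∧
    (∃ B : ℝ, ∀ y ∈ Set.Ioo 0 (a / 2),
      ‖derivWithin F (Set.Ioo 0 a) y‖ ≤ B) := by
  have hhalf : 0 < a / 2 := by positivity
  have hsub : ∀ x ∈ Set.Ioc 0 (a / 2), x ∈ Set.Ioo 0 a := fun x hx =>
    ⟨hx.1, by linarith [hx.2]⟩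
  have hderiv : ∀ j < M + 2, ∀ x ∈ Set.Ioc 0 (a / 2),
      HasDerivAt (iteratedDerivWithin j F (Set.Ioo 0 a))
        (iteratedDerivWithin (j + 1) F (Set.Ioo 0 a) x) x := by
    intro j hj x hx
    rw [iteratedDerivWithin_succ]
    exact (hdiff j hj x (hsub x hx)).hasDerivWithinAt.hasDerivAt
      (isOpen_Ioo.mem_nhds (hsub x hx))
  have hdesc : ∀ k m : ℕ, m + k = M → ∃ K, 0 ≤ K ∧ ∀ y ∈ Set.Ioc 0 (a / 2),
      ‖iteratedDerivWithin (m + 2) F (Set.Ioo 0 a) y‖ ≤ K * y ^ (-((m : ℝ) + 1 / 2)) := by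
    intro k
    induction k with
    | zero =>
      rintro m rfl
      refine ⟨C * a ^ (1 / 2 : ℝ), by positivity, fun y hy => ?_⟩
      refine (hbound y (hsub y hy)).trans ?_
      have hy0 := hy.1
      have hpow : y ^ (-((m : ℝ) + 1 / 2)) * y ^ (1 / 2 : ℝ) = (y ^ m)⁻¹ := by
        rw [← Real.rpow_add hy0, ← Real.rpow_natCast, ← Real.rpow_neg hy0.le]
        congr 1
        ring
      rw [add_zero, div_eq_mul_inv, ← hpow, mul_assoc, mul_comm (a ^ _)]
      gcongr
      exact (hsub y hy).2.le
    | succ k ih =>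
      intro m hm
      obtain ⟨K, hK, hKb⟩ := ih (m + 1) (by omega)
      obtain ⟨K', hK', hb⟩ := exists_norm_le_rpow_of_one_lt
        (s := ((m + 1 : ℕ) : ℝ) + 1 / 2) (by push_cast; linarith [m.cast_nonneg (α := ℝ)]) hK
        (hderiv (m + 2) (by omega)) hKb
      refine ⟨K', hK', fun y hy => (hb y hy).trans_eq ?_⟩
      congr 2
      push_cast
      ring
  obtain ⟨K, hK, hKb⟩ := hdesc M 0 (by simp)
  obtain ⟨B, hB⟩ := exists_norm_le_of_lt_one (s := ((0 : ℕ) : ℝ) + 1 / 2) (by norm_num) hK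
    (hderiv 1 (by omega)) hKb
  have hF : ∀ x ∈ Set.Ioc 0 (a / 2),
      HasDerivAt F (iteratedDerivWithin 1 F (Set.Ioo 0 a) x) x := by
    simpa using hderiv 0 (by omega)
  refine ⟨?_, B, fun y hy => ?_⟩
  · have hlip : LipschitzOnWith B.toNNReal F (Set.Ioc 0 (a / 2)) :=
      (convex_Ioc 0 (a / 2)).lipschitzOnWith_of_nnnorm_hasDerivWithin_le
        (fun x hx => (hF x hx).hasDerivWithinAt)
        (fun x hx => by
          rw [← norm_toNNReal]
          exact Real.toNNReal_le_toNNReal (hB x hx))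
    have hcauchy : Cauchy (map F (nhdsWithin 0 (Set.Ioi 0))) :=
      (cauchy_nhds.mono nhdsWithin_le_nhds).map_of_le hlip.uniformContinuousOn
        (le_principal_iff.mpr (Ioc_mem_nhdsGT hhalf))
    exact CompleteSpace.complete hcauchy
  · rw [← iteratedDerivWithin_one]
    exact hB y ⟨hy.1, hy.2.le⟩
end

section
/- Let f : ℝ → ℂ be a Schwartz function. Then the series ∑_{n=0}^∞ ∫_ℝ f(τ) e^{inτ} dτ converges absolutely, the integral ∫_ℝ f(τ) (1 - e^{-ε+iτ})^{-1} dτ is well-defined for every ε > 0, and lim_{ε→0+} ∫_ℝ f(τ) (1 - e^{-ε+iτ})^{-1} dτ = ∑_{n=0}^∞ ∫_ℝ f(τ) e^{inτ} dτ. -/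
open MeasureTheory Filter Complex

lemma norm_exp_neg_add_I_mul (ε τ : ℝ) :
    ‖Complex.exp (-↑ε + Complex.I * τ)‖ = Real.exp (-ε) := by
  simp [Complex.norm_exp]

lemma SchwartzMap.integral_mul_exp_eq_fourier (f : SchwartzMap ℝ ℂ) (n : ℕ) :
    ∫ τ : ℝ, f τ * Complex.exp (Complex.I * n * τ) =
      FourierTransform.fourier f (-(n / (2 * Real.pi))) := by
  rw [SchwartzMap.fourier_coe, Real.fourier_real_eq_integral_exp_smul]
  refine integral_congr_ae (Eventually.of_forall fun τ => ?_)
  have hpi : (Real.pi : ℂ) ≠ 0 := Complex.ofReal_ne_zero.mpr Real.pi_ne_zero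
  simp only [smul_eq_mul]
  rw [mul_comm]
  congr 2
  push_cast
  field_simp

lemma SchwartzMap.summable_norm_integral_mul_exp (f : SchwartzMap ℝ ℂ) :
    Summable (fun n : ℕ => ‖∫ τ : ℝ, f τ * Complex.exp (Complex.I * n * τ)‖) := by
  obtain ⟨C, -, hC⟩ := (FourierTransform.fourier f : SchwartzMap ℝ ℂ).decay 2 0
  have hs : Summable fun n : ℕ => C * (2 * Real.pi) ^ 2 * (1 / (n : ℝ) ^ 2) :=
    (Real.summable_one_div_nat_pow.mpr one_lt_two).mul_left _
  refine hs.of_norm_bounded_eventually_nat ?_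
  filter_upwards [eventually_gt_atTop 0] with n hn
  have hn' : (0 : ℝ) < n := Nat.cast_pos.mpr hn
  have h := hC (-(n / (2 * Real.pi)))
  rw [norm_iteratedFDeriv_zero, norm_neg, Real.norm_eq_abs, sq_abs] at h
  rw [norm_norm, f.integral_mul_exp_eq_fourier, mul_one_div, le_div_iff₀ (by positivity)]
  rw [div_pow, div_mul_eq_mul_div, div_le_iff₀ (by positivity)] at h
  linarith

lemma SchwartzMap.integrable_mul_inv_one_sub_exp (f : SchwartzMap ℝ ℂ) {ε : ℝ} (hε : 0 < ε) :
    Integrable (fun τ : ℝ => f τ * (1 - Complex.exp (-↑ε + Complex.I * τ))⁻¹) := by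
  have hlt : Real.exp (-ε) < 1 := Real.exp_lt_one_iff.mpr (neg_lt_zero.mpr hε)
  refine f.integrable.mul_bdd (c := (1 - Real.exp (-ε))⁻¹)
    (Measurable.aestronglyMeasurable (by fun_prop)) (Eventually.of_forall fun τ => ?_)
  rw [norm_inv]
  refine inv_anti₀ (sub_pos.mpr hlt) ?_
  simpa [norm_exp_neg_add_I_mul] using
    norm_sub_norm_le (1 : ℂ) (Complex.exp (-↑ε + Complex.I * τ))

lemma SchwartzMap.integral_mul_inv_one_sub_exp (f : SchwartzMap ℝ ℂ) {ε : ℝ} (hε : 0 < ε) :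
    ∫ τ : ℝ, f τ * (1 - Complex.exp (-↑ε + Complex.I * τ))⁻¹ =
      ∑' n : ℕ, (Real.exp (-ε) : ℂ) ^ n *
        ∫ τ : ℝ, f τ * Complex.exp (Complex.I * n * τ) := by
  have hlt : Real.exp (-ε) < 1 := Real.exp_lt_one_iff.mpr (neg_lt_zero.mpr hε)
  have hnorm (n : ℕ) (τ : ℝ) : ‖f τ * Complex.exp (-↑ε + Complex.I * τ) ^ n‖ =
      ‖f τ‖ * Real.exp (-ε) ^ n := by
    rw [norm_mul, norm_pow, norm_exp_neg_add_I_mul]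
  have hint (n : ℕ) :
      Integrable (fun τ : ℝ => f τ * Complex.exp (-↑ε + Complex.I * τ) ^ n) := by
    refine f.integrable.mul_bdd (c := Real.exp (-ε) ^ n)
      (Continuous.aestronglyMeasurable (by fun_prop)) (Eventually.of_forall fun τ => ?_)
    rw [norm_pow, norm_exp_neg_add_I_mul]
  have hsum : Summable fun n : ℕ =>
      ∫ τ : ℝ, ‖f τ * Complex.exp (-↑ε + Complex.I * τ) ^ n‖ := by
    simp only [hnorm, integral_mul_const]
    exact (summable_geometric_of_lt_one (Real.exp_pos _).le hlt).mul_left _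
  have hgeom (τ : ℝ) : f τ * (1 - Complex.exp (-↑ε + Complex.I * τ))⁻¹ =
      ∑' n : ℕ, f τ * Complex.exp (-↑ε + Complex.I * τ) ^ n := by
    rw [tsum_mul_left, tsum_geometric_of_norm_lt_one (by rwa [norm_exp_neg_add_I_mul])]
  simp only [hgeom]
  rw [← integral_tsum_of_summable_integral_norm hint hsum]
  refine tsum_congr fun n => ?_
  rw [← integral_const_mul]
  refine integral_congr_ae (Eventually.of_forall fun τ => ?_)
  simp only [Complex.ofReal_exp, ← Complex.exp_nat_mul]
  rw [mul_left_comm, ← Complex.exp_add]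
  congr 2
  push_cast
  ring

/-- **The toy model: `∑_{n≥0} e^{inτ} = lim_{ε→0+} (1 - e^{-ε+iτ})⁻¹` as distributions.**
For any Schwartz function `f`, the series `∑_n ∫ f(τ) e^{inτ} dτ` converges absolutely,
the regulated integrals are well-defined, and
`lim_{ε→0+} ∫ f(τ)/(1 - e^{-ε+iτ}) dτ = ∑_{n=0}^∞ ∫ f(τ) e^{inτ} dτ`. -/
theorem toy_distributional_convergence
    (f : SchwartzMap ℝ ℂ) :
    Summable (fun n : ℕ => ‖∫ τ : ℝ, f τ * Complex.exp (Complex.I * n * τ)‖) ∧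
    (∀ ε : ℝ, 0 < ε →
      Integrable (fun τ : ℝ => f τ * (1 - Complex.exp (-↑ε + Complex.I * τ))⁻¹)) ∧
    Tendsto
      (fun ε : ℝ => ∫ τ : ℝ, f τ * (1 - Complex.exp (-↑ε + Complex.I * τ))⁻¹)
      (nhdsWithin 0 (Set.Ioi 0))
      (nhds (∑' n : ℕ, ∫ τ : ℝ, f τ * Complex.exp (Complex.I * n * τ))) := by
  refine ⟨f.summable_norm_integral_mul_exp,
    fun ε hε => f.integrable_mul_inv_one_sub_exp hε, ?_⟩
  have hlim : Tendsto (fun ε : ℝ => ∑' n : ℕ, (Real.exp (-ε) : ℂ) ^ n *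
        ∫ τ : ℝ, f τ * Complex.exp (Complex.I * n * τ)) (nhdsWithin 0 (Set.Ioi 0))
      (nhds (∑' n : ℕ, ∫ τ : ℝ, f τ * Complex.exp (Complex.I * n * τ))) := by
    refine tendsto_tsum_of_dominated_convergence f.summable_norm_integral_mul_exp
      (fun n => ?_) ?_
    · have hcont : Continuous fun ε : ℝ => (Real.exp (-ε) : ℂ) ^ n *
          ∫ τ : ℝ, f τ * Complex.exp (Complex.I * n * τ) := by fun_prop
      simpa using (hcont.tendsto 0).mono_left nhdsWithin_le_nhds
    · filter_upwards [self_mem_nhdsWithin] with ε hε n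
      rw [norm_mul, norm_pow, Complex.norm_real, Real.norm_of_nonneg (Real.exp_pos _).le]
      refine mul_le_of_le_one_left (norm_nonneg _) (pow_le_one₀ (Real.exp_pos _).le ?_)
      exact Real.exp_le_one_iff.mpr (neg_nonpos.mpr (Set.mem_Ioi.mp hε).le)
  refine hlim.congr' ?_
  filter_upwards [self_mem_nhdsWithin] with ε hε
  exact (f.integral_mul_inv_one_sub_exp hε).symm
end

section
/- Let (p_n) be a sequence of nonnegative reals and (Δ_n) a sequence of nonnegative reals. Suppose that for every y > 0 the series ∑_n p_n e^{-Δ_n y} converges, and that there exist C > 0 and a nonnegative integer M with ∑_n p_n e^{-Δ_n y} ≤ C y^{-M} for all y ∈ (0,1). Define g(τ) = ∑_n p_n e^{iΔ_n τ} for Im τ > 0 (the series converges absolutely there and g is holomorphic). Then for every Schwartz function f : ℝ → ℂ: (i) the series ∑_n p_n ∫_ℝ e^{iΔ_n τ} f(τ) dτ converges; (ii) the limit lim_{y→0+} ∫_ℝ g(τ+iy) f(τ) dτ exists; and (iii) the two quantities are equal. -/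
open MeasureTheory Filter Complex

/-- Abelian growth of order `M` at `0` of a nonnegative generalized Dirichlet series bounds the
polynomially weighted sum of its coefficients. -/
theorem summable_mul_inv_one_add_pow_of_tsum_exp_le
    {p Δ : ℕ → ℝ} (hp : ∀ n, 0 ≤ p n) (hΔ : ∀ n, 0 ≤ Δ n)
    (hsum : ∀ y : ℝ, 0 < y → Summable (fun n => p n * Real.exp (-(Δ n) * y)))
    {C : ℝ} {M : ℕ}
    (hbound : ∀ y : ℝ, 0 < y → y < 1 →
      (∑' n, p n * Real.exp (-(Δ n) * y)) ≤ C / y ^ M) :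
    Summable (fun n => p n * ((1 + Δ n) ^ (M + 1))⁻¹) := by
  obtain ⟨y, hy⟩ : ∃ y : ℕ → ℝ, ∀ k, y k = (1 / 2 : ℝ) ^ (k + 1) := ⟨_, fun _ => rfl⟩
  have hy0 (k : ℕ) : 0 < y k := by rw [hy]; positivity
  have hy1 (k : ℕ) : y k < 1 := hy k ▸ pow_lt_one₀ (by norm_num) (by norm_num) (by simp)
  have hsummable : Summable (fun q : ℕ × ℕ =>
      y q.1 ^ (M + 1) * (p q.2 * Real.exp (-(Δ q.2) * y q.1))) := by
    have hnonneg (q : ℕ × ℕ) :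
        0 ≤ y q.1 ^ (M + 1) * (p q.2 * Real.exp (-(Δ q.2) * y q.1)) :=
      mul_nonneg (pow_nonneg (hy0 _).le _) (mul_nonneg (hp _) (Real.exp_pos _).le)
    refine (summable_prod_of_nonneg hnonneg).2
      ⟨fun k => (hsum (y k) (hy0 k)).mul_left (y k ^ (M + 1)), ?_⟩
    have hgeom : Summable (fun k => C * y k) := by
      simp only [hy, pow_succ]
      exact ((summable_geometric_of_lt_one (by norm_num) (by norm_num)).mul_right _).mul_left C
    refine hgeom.of_nonneg_of_le (fun k => tsum_nonneg fun n => hnonneg (k, n)) fun k => ?_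
    simp only [tsum_mul_left]
    calc y k ^ (M + 1) * ∑' n, p n * Real.exp (-(Δ n) * y k)
        ≤ y k ^ (M + 1) * (C / y k ^ M) :=
          mul_le_mul_of_nonneg_left (hbound _ (hy0 k) (hy1 k)) (pow_nonneg (hy0 k).le _)
      _ = C * y k := by
          have := (hy0 k).ne'
          field_simp
          ring
  have hdyadic (n : ℕ) : ∃ k : ℕ, (2 : ℝ) ^ k ≤ 1 + Δ n ∧ 1 + Δ n < 2 ^ (k + 1) :=
    exists_nat_pow_near (by linarith [hΔ n]) (by norm_num)
  choose k hk_le hk_lt using hdyadic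
  have hdiag := hsummable.comp_injective (i := fun n => (k n, n))
    (fun a b hab => congrArg Prod.snd hab)
  refine (hdiag.mul_left (2 ^ (M + 1) * Real.exp 1)).of_nonneg_of_le
    (fun n => mul_nonneg (hp n) (inv_nonneg.2 (pow_nonneg (by linarith [hΔ n]) _))) fun n => ?_
  have hone : 0 < 1 + Δ n := by linarith [hΔ n]
  have hinv : (1 + Δ n)⁻¹ ≤ 2 * y (k n) := by
    have : 2 * y (k n) = ((2 : ℝ) ^ k n)⁻¹ := by
      simp only [hy, pow_succ, one_div, inv_pow]
      ring
    rw [this]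
    exact inv_anti₀ (by positivity) (hk_le n)
  have hprod : Δ n * y (k n) ≤ 1 := by
    have : (2 : ℝ) ^ (k n + 1) * y (k n) = 1 := by
      simp [hy]
    nlinarith [hy0 (k n), hk_lt n]
  have hexp : 1 ≤ Real.exp 1 * Real.exp (-(Δ n) * y (k n)) := by
    rw [← Real.exp_add]
    exact Real.one_le_exp (by linarith)
  have hpow : ((1 + Δ n) ^ (M + 1))⁻¹ ≤ 2 ^ (M + 1) * y (k n) ^ (M + 1) := by
    rw [← inv_pow, ← mul_pow]
    exact pow_le_pow_left₀ (inv_nonneg.2 hone.le) hinv _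
  calc p n * ((1 + Δ n) ^ (M + 1))⁻¹
      ≤ p n * (2 ^ (M + 1) * y (k n) ^ (M + 1)) := mul_le_mul_of_nonneg_left hpow (hp n)
    _ ≤ p n * (2 ^ (M + 1) * y (k n) ^ (M + 1)) *
          (Real.exp 1 * Real.exp (-(Δ n) * y (k n))) :=
        le_mul_of_one_le_right
          (mul_nonneg (hp n) (mul_nonneg (by positivity) (pow_nonneg (hy0 _).le _))) hexp
    _ = _ := by
        simp only [Function.comp_apply]
        ring

/-- The oscillatory integrals of a Schwartz function decay polynomially in the frequency. -/
theorem SchwartzMap.exists_norm_integral_exp_mul_le (f : SchwartzMap ℝ ℂ) (N : ℕ) :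
    ∃ K : ℝ, ∀ a : ℝ, 0 ≤ a →
      ‖∫ τ : ℝ, Complex.exp (Complex.I * a * τ) * f τ‖ ≤ K * ((1 + a) ^ N)⁻¹ := by
  obtain ⟨A, hA⟩ : ∃ A : ℝ, ∀ x : ℝ, (1 + ‖x‖) ^ N * ‖FourierTransform.fourier f x‖ ≤ A :=
    ⟨_, fun x => by
      simpa using SchwartzMap.one_add_le_sup_seminorm_apply (𝕜 := ℂ) (m := (N, 0))
        le_rfl le_rfl (FourierTransform.fourier f) x⟩
  refine ⟨(2 * Real.pi) ^ N * A, fun a ha => ?_⟩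
  have hpi := Real.pi_gt_three
  have heq : ∫ τ : ℝ, Complex.exp (Complex.I * a * τ) * f τ =
      FourierTransform.fourier f (-(a / (2 * Real.pi))) := by
    rw [SchwartzMap.fourier_coe, Real.fourier_real_eq_integral_exp_smul]
    refine integral_congr_ae (.of_forall fun τ => ?_)
    have : (Real.pi : ℂ) ≠ 0 := by exact_mod_cast Real.pi_ne_zero
    simp only [smul_eq_mul]
    congr 2
    push_cast
    field_simp
  have hle : 1 + a ≤ 2 * Real.pi * (1 + ‖-(a / (2 * Real.pi))‖) := by
    rw [norm_neg, Real.norm_of_nonneg (by positivity), mul_add,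
      mul_div_cancel₀ _ (by positivity)]
    linarith
  rw [heq, ← div_eq_mul_inv, le_div_iff₀ (by positivity), mul_comm]
  calc (1 + a) ^ N * ‖FourierTransform.fourier f (-(a / (2 * Real.pi)))‖
      ≤ (2 * Real.pi * (1 + ‖-(a / (2 * Real.pi))‖)) ^ N *
          ‖FourierTransform.fourier f (-(a / (2 * Real.pi)))‖ := by gcongr
    _ = (2 * Real.pi) ^ N * ((1 + ‖-(a / (2 * Real.pi))‖) ^ N *
          ‖FourierTransform.fourier f (-(a / (2 * Real.pi)))‖) := by
        rw [mul_pow, mul_assoc]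
    _ ≤ (2 * Real.pi) ^ N * A := mul_le_mul_of_nonneg_left (hA _) (by positivity)

/-- **Distributional convergence of a positive generalized power series on the boundary.**
Given nonnegative coefficients `p n` and exponents `Δ n` with `∑_n p_n e^{-Δ_n y} ≤ C y^{-M}`
for `y ∈ (0,1)`, the function `g(τ) = ∑_n p_n e^{iΔ_n τ}` (holomorphic for `Im τ > 0`)
has a distributional boundary value on ℝ and the series may be integrated term by term:
for every Schwartz `f`, `∑_n p_n ∫ e^{iΔ_n τ} f(τ) dτ` converges,
`lim_{y→0+} ∫ g(τ+iy) f(τ) dτ` exists, and the two are equal. -/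
theorem series_boundary_value_term_by_term
    (p Δ : ℕ → ℝ) (hp : ∀ n, 0 ≤ p n) (hΔ : ∀ n, 0 ≤ Δ n)
    (hsum : ∀ y : ℝ, 0 < y → Summable (fun n => p n * Real.exp (-(Δ n) * y)))
    (C : ℝ) (hC : 0 < C) (M : ℕ)
    (hbound : ∀ y : ℝ, 0 < y → y < 1 →
      (∑' n, p n * Real.exp (-(Δ n) * y)) ≤ C / y ^ M)
    (f : SchwartzMap ℝ ℂ) :
    Summable (fun n : ℕ =>
      (p n : ℂ) * ∫ τ : ℝ, Complex.exp (Complex.I * Δ n * τ) * f τ) ∧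
    Tendsto
      (fun y : ℝ => ∫ τ : ℝ,
        (∑' n : ℕ, (p n : ℂ) * Complex.exp (Complex.I * Δ n * (↑τ + ↑y * Complex.I))) * f τ)
      (nhdsWithin 0 (Set.Ioi 0))
      (nhds (∑' n : ℕ, (p n : ℂ) * ∫ τ : ℝ, Complex.exp (Complex.I * Δ n * τ) * f τ)) := by
  obtain ⟨K, hK⟩ := f.exists_norm_integral_exp_mul_le (M + 1)
  have hdom : Summable (fun n => K * (p n * ((1 + Δ n) ^ (M + 1))⁻¹)) :=
    (summable_mul_inv_one_add_pow_of_tsum_exp_le hp hΔ hsum hbound).mul_left K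
  have hle (n : ℕ) : ‖(p n : ℂ) * ∫ τ : ℝ, Complex.exp (Complex.I * Δ n * τ) * f τ‖ ≤
      K * (p n * ((1 + Δ n) ^ (M + 1))⁻¹) := by
    rw [norm_mul, Complex.norm_of_nonneg (hp n), mul_left_comm]
    exact mul_le_mul_of_nonneg_left (hK _ (hΔ n)) (hp n)
  refine ⟨hdom.of_norm_bounded hle, ?_⟩
  have hswap (y : ℝ) (hy : 0 < y) :
      ∑' n : ℕ, (Real.exp (-(Δ n) * y) : ℂ) *
        ((p n : ℂ) * ∫ τ : ℝ, Complex.exp (Complex.I * Δ n * τ) * f τ) =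
      ∫ τ : ℝ, (∑' n : ℕ, (p n : ℂ) *
        Complex.exp (Complex.I * Δ n * (↑τ + ↑y * Complex.I))) * f τ := by
    have hnorm (n : ℕ) (τ : ℝ) :
        ‖(p n : ℂ) * Complex.exp (Complex.I * Δ n * (↑τ + ↑y * Complex.I))‖ =
          p n * Real.exp (-(Δ n) * y) := by
      rw [norm_mul, Complex.norm_of_nonneg (hp n), Complex.norm_exp]
      simp
    have hint (n : ℕ) : Integrable (fun τ : ℝ =>
        (p n : ℂ) * Complex.exp (Complex.I * Δ n * (↑τ + ↑y * Complex.I)) * f τ) :=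
      f.integrable.bdd_mul (Continuous.aestronglyMeasurable (by fun_prop))
        (.of_forall fun τ => (hnorm n τ).le)
    simp_rw [← tsum_mul_right]
    rw [← integral_tsum_of_summable_integral_norm hint]
    · refine tsum_congr fun n => ?_
      rw [← mul_assoc, ← integral_const_mul]
      refine integral_congr_ae (.of_forall fun τ => ?_)
      have hexp : Complex.exp (Complex.I * Δ n * (↑τ + ↑y * Complex.I)) =
          (Real.exp (-(Δ n) * y) : ℂ) * Complex.exp (Complex.I * Δ n * τ) := by
        rw [Complex.ofReal_exp, ← Complex.exp_add]
        congr 1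
        push_cast
        linear_combination (Δ n * y : ℂ) * Complex.I_mul_I
      simp only [hexp]
      ring
    · simp_rw [norm_mul _ (f _), hnorm, integral_const_mul]
      exact (hsum y hy).mul_right _
  refine Tendsto.congr' (eventually_nhdsWithin_of_forall hswap) ?_
  refine tendsto_tsum_of_dominated_convergence hdom (fun n => ?_)
    (eventually_nhdsWithin_of_forall fun y hy n => ?_)
  · have hcont : Continuous (fun y : ℝ => (Real.exp (-(Δ n) * y) : ℂ) *
        ((p n : ℂ) * ∫ τ : ℝ, Complex.exp (Complex.I * Δ n * τ) * f τ)) := by fun_prop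
    simpa using (hcont.tendsto 0).mono_left nhdsWithin_le_nhds
  · rw [norm_mul, Complex.norm_of_nonneg (Real.exp_pos _).le]
    refine (mul_le_of_le_one_left (norm_nonneg _) (Real.exp_le_one_iff.2 ?_)).trans (hle n)
    nlinarith [hΔ n, Set.mem_Ioi.1 hy]
end

section
/- Let 𝔻 = {w ∈ ℂ : |w| < 1} and let φ : 𝔻 → ℂ be a holomorphic injective map whose image is contained in 𝔻 \ (-1,0]. Then there exists a constant C' > 0 such that |φ(w)| ≥ C' (1 - |w|)^2 for all w ∈ 𝔻. -/
open Complex Metric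

/-- A holomorphic map from the unit disk to the right half-plane decays at most linearly in the
distance to the unit circle. -/
theorem norm_mul_one_sub_norm_le_of_re_pos {s : ℂ → ℂ}
    (hs : DifferentiableOn ℂ s (ball (0 : ℂ) 1)) (hre : ∀ w ∈ ball (0 : ℂ) 1, 0 < (s w).re)
    {w : ℂ} (hw : w ∈ ball (0 : ℂ) 1) :
    ‖s 0‖ * (1 - ‖w‖) ≤ 2 * ‖s w‖ := by
  set a := s 0 with ha
  have ha0 : 0 < a.re := hre 0 (by simp)
  have hden : ∀ z ∈ ball (0 : ℂ) 1, s z + (starRingEnd ℂ) a ≠ 0 := by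
    intro z hz h
    have := congrArg Complex.re h
    simp only [add_re, conj_re, zero_re] at this
    linarith [hre z hz]
  let g : ℂ → ℂ := fun z => (s z - a) / (s z + (starRingEnd ℂ) a)
  have hg : DifferentiableOn ℂ g (ball 0 1) :=
    (hs.sub_const a).div (hs.add_const _) hden
  have hmaps : Set.MapsTo g (ball 0 1) (ball 0 1) := by
    intro z hz
    rw [mem_ball_zero_iff, norm_div, div_lt_one (norm_pos_iff.2 (hden z hz)),
      ← sq_lt_sq₀ (norm_nonneg _) (norm_nonneg _), Complex.sq_norm, Complex.sq_norm,
      normSq_apply, normSq_apply]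
    simp only [sub_re, sub_im, add_re, add_im, conj_re, conj_im]
    nlinarith [mul_pos (hre z hz) ha0]
  have hgw : ‖g w‖ ≤ ‖w‖ :=
    norm_le_norm_of_mapsTo_ball hg (hmaps.mono_right ball_subset_closedBall) (by simp [g, ha])
      (mem_ball_zero_iff.1 hw)
  have hid : s w * (1 - g w) = a + (starRingEnd ℂ) a * g w := by
    have := hden w hw
    simp only [g]
    field_simp
    ring
  have hw1 : ‖w‖ < 1 := mem_ball_zero_iff.1 hw
  calc ‖a‖ * (1 - ‖w‖) ≤ ‖a‖ * (1 - ‖g w‖) := by gcongr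
    _ = ‖a‖ - ‖(starRingEnd ℂ) a * g w‖ := by rw [norm_mul, norm_conj]; ring
    _ ≤ ‖a + (starRingEnd ℂ) a * g w‖ := norm_sub_le_norm_add _ _
    _ = ‖s w‖ * ‖1 - g w‖ := by rw [← hid, norm_mul]
    _ ≤ ‖s w‖ * 2 := by
        gcongr
        linarith [norm_sub_le 1 (g w), norm_one (α := ℂ)]
    _ = 2 * ‖s w‖ := mul_comm _ _

/-- The principal square root, written as `exp (log z / 2)`, maps the slit plane to the right
half-plane. -/
theorem re_exp_log_div_two_pos {z : ℂ} (hz : z ∈ slitPlane) : 0 < (exp (log z / 2)).re := by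
  have harg := mem_slitPlane_iff_arg.1 hz
  have him : (log z / 2).im = z.arg / 2 := by simp [log_im]
  rw [exp_re, him]
  refine mul_pos (Real.exp_pos _) (Real.cos_pos_of_mem_Ioo ⟨?_, ?_⟩)
  · linarith [neg_pi_lt_arg z]
  · linarith [lt_of_le_of_ne (arg_le_pi z) harg.1]

/-- **Second bound of the lemma on univalent maps into the cut disk.**
If `φ : 𝔻 → 𝔻 \ (-1,0]` is holomorphic and injective, then `|φ(w)| ≥ C' (1 - |w|)²`. -/
theorem cut_disk_map_lower_bound_two
    (φ : ℂ → ℂ)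
    (hφ : DifferentiableOn ℂ φ (ball (0 : ℂ) 1))
    (hinj : Set.InjOn φ (ball (0 : ℂ) 1))
    (himg : ∀ w ∈ ball (0 : ℂ) 1,
      φ w ∈ ball (0 : ℂ) 1 \ (Complex.ofReal '' Set.Ioc (-1 : ℝ) 0)) :
    ∃ C' : ℝ, 0 < C' ∧ ∀ w ∈ ball (0 : ℂ) 1,
      C' * (1 - ‖w‖) ^ 2 ≤ ‖φ w‖ := by
  have hslit : ∀ w ∈ ball (0 : ℂ) 1, φ w ∈ slitPlane := by
    intro w hw
    obtain ⟨hball, hcut⟩ := himg w hw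
    by_contra h
    rw [mem_slitPlane_iff, not_or, not_lt, not_not] at h
    refine hcut ⟨(φ w).re, ⟨?_, h.1⟩, Complex.ext (by simp) (by simp [h.2])⟩
    linarith [neg_le_of_abs_le (abs_re_le_norm (φ w)), mem_ball_zero_iff.1 hball]
  let s : ℂ → ℂ := fun w => exp (log (φ w) / 2)
  have hsq : ∀ w ∈ ball (0 : ℂ) 1, ‖s w‖ ^ 2 = ‖φ w‖ := by
    intro w hw
    rw [← norm_pow, ← exp_nat_mul, Nat.cast_ofNat, mul_div_cancel₀ _ two_ne_zero,
      exp_log (slitPlane_ne_zero (hslit w hw))]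
  have hs : DifferentiableOn ℂ s (ball 0 1) := ((hφ.clog hslit).div_const 2).cexp
  have h0 : (0 : ℂ) ∈ ball (0 : ℂ) 1 := by simp
  refine ⟨‖φ 0‖ / 4, by have := slitPlane_ne_zero (hslit 0 h0); positivity, fun w hw => ?_⟩
  have hbound := norm_mul_one_sub_norm_le_of_re_pos hs
    (fun z hz => re_exp_log_div_two_pos (hslit z hz)) hw
  have hnonneg : 0 ≤ ‖s 0‖ * (1 - ‖w‖) :=
    mul_nonneg (norm_nonneg _) (by linarith [mem_ball_zero_iff.1 hw])
  rw [← hsq 0 h0, ← hsq w hw]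
  nlinarith [pow_le_pow_left₀ hnonneg hbound 2]
end

section
/- Let 𝔻 = {w ∈ ℂ : |w| < 1}, let C > 0 and M ≥ 0, and let g be holomorphic on 𝔻 with |g(w)| ≤ C (1 - |w|)^{-M} for all w ∈ 𝔻. Then for every smooth 2π-periodic function f : ℝ → ℂ, the limit lim_{r→1⁻} ∫_0^{2π} g(r e^{iθ}) f(θ) dθ exists and is finite. -/
open MeasureTheory Filter Complex Metric

/-- The Taylor coefficients at `0` of a holomorphic function of polynomial growth on the unit disk
grow at most polynomially. -/
theorem norm_taylorCoeff_le_of_polynomial_growth {C M : ℝ} (hC : 0 ≤ C) {K : ℕ} (hK : M ≤ K)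
    {g : ℂ → ℂ} (hg : DifferentiableOn ℂ g (ball (0 : ℂ) 1))
    (hbound : ∀ w ∈ ball (0 : ℂ) 1, ‖g w‖ ≤ C / (1 - ‖w‖) ^ M) (n : ℕ) :
    ‖(n.factorial : ℂ)⁻¹ * iteratedDeriv n g 0‖ ≤ Real.exp 1 * C * ((n : ℝ) + 2) ^ K := by
  set R : ℝ := ((n : ℝ) + 1) / (n + 2) with hR
  have hRpos : 0 < R := by positivity
  have hR1 : R < 1 := by rw [hR, div_lt_one (by positivity)]; linarith
  have hsphere : ∀ z ∈ sphere (0 : ℂ) R, ‖g z‖ ≤ C * ((n : ℝ) + 2) ^ K := by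
    intro z hz
    have hz' : ‖z‖ = R := by simpa using hz
    have h := hbound z (by simpa [hz'] using hR1)
    have hsub : 1 - ‖z‖ = ((n : ℝ) + 2)⁻¹ := by rw [hz', hR]; field_simp; ring
    rw [hsub, Real.inv_rpow (by positivity), div_inv_eq_mul] at h
    refine h.trans (mul_le_mul_of_nonneg_left ?_ hC)
    rw [← Real.rpow_natCast]
    exact Real.rpow_le_rpow_of_exponent_le (by linarith [(n.cast_nonneg : (0 : ℝ) ≤ n)]) hK
  have hd : DiffContOnCl ℂ g (ball 0 R) :=
    (hg.mono (closedBall_subset_ball hR1)).diffContOnCl_ball subset_rfl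
  have hcauchy := norm_iteratedDeriv_le_of_forall_mem_sphere_norm_le n hRpos hd hsphere
  have hRn : (R ^ n)⁻¹ ≤ Real.exp 1 := by
    have h1 : R⁻¹ ≤ Real.exp (1 / ((n : ℝ) + 1)) := by
      refine le_trans (le_of_eq ?_) (Real.add_one_le_exp _)
      rw [hR]; field_simp; ring
    calc (R ^ n)⁻¹ = R⁻¹ ^ n := (inv_pow _ _).symm
      _ ≤ Real.exp (1 / ((n : ℝ) + 1)) ^ n := by gcongr
      _ = Real.exp (n * (1 / ((n : ℝ) + 1))) := (Real.exp_nat_mul _ _).symm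
      _ ≤ Real.exp 1 := by
        gcongr
        rw [mul_one_div, div_le_one (by positivity)]
        linarith
  have hfac : (0 : ℝ) < n.factorial := by positivity
  rw [norm_mul, norm_inv, Complex.norm_natCast]
  calc (n.factorial : ℝ)⁻¹ * ‖iteratedDeriv n g 0‖
      ≤ (n.factorial : ℝ)⁻¹ * (n.factorial * (C * ((n : ℝ) + 2) ^ K) / R ^ n) := by gcongr
    _ = (R ^ n)⁻¹ * (C * ((n : ℝ) + 2) ^ K) := by field_simp
    _ ≤ Real.exp 1 * (C * ((n : ℝ) + 2) ^ K) := by gcongr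
    _ = Real.exp 1 * C * ((n : ℝ) + 2) ^ K := by ring

/-- Integration by parts over a period against an exponential. -/
theorem integral_exp_mul_deriv_of_periodic {f : ℝ → ℂ} (hf : ContDiff ℝ 1 f)
    (hper : Function.Periodic f (2 * Real.pi)) (n : ℕ) :
    ∫ θ in (0 : ℝ)..(2 * Real.pi), Complex.exp (n * (θ * Complex.I)) * deriv f θ =
      -(n * Complex.I) *
        ∫ θ in (0 : ℝ)..(2 * Real.pi), Complex.exp (n * (θ * Complex.I)) * f θ := by
  have hu : ∀ x : ℝ, HasDerivAt (fun θ : ℝ => Complex.exp (n * (θ * Complex.I)))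
      (Complex.exp (n * (x * Complex.I)) * (n * Complex.I)) x := by
    intro x
    have h := (((Complex.ofRealCLM.hasDerivAt (x := x)).mul_const Complex.I).const_mul
      (n : ℂ)).cexp
    simpa using h
  rw [intervalIntegral.integral_mul_deriv_eq_deriv_mul (fun x _ => hu x)
    (fun x _ => (hf.differentiable one_ne_zero x).hasDerivAt)
    (Continuous.intervalIntegrable (by fun_prop) _ _)
    ((hf.continuous_deriv le_rfl).intervalIntegrable _ _), ← intervalIntegral.integral_const_mul]
  have hf0 : f (2 * Real.pi) = f 0 := by simpa using hper 0
  have he : Complex.exp (n * ((2 * Real.pi : ℝ) * Complex.I)) = 1 := by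
    push_cast
    exact Complex.exp_nat_mul_two_pi_mul_I n
  rw [hf0, he]
  simp only [Complex.ofReal_zero, zero_mul, mul_zero, Complex.exp_zero, one_mul, sub_self,
    zero_sub, ← intervalIntegral.integral_neg]
  congr 1
  ext x
  ring

/-- Fourier coefficients of a smooth periodic function decay faster than any power. -/
theorem exists_pow_mul_norm_integral_exp_mul_le (k : ℕ) :
    ∀ {f : ℝ → ℂ}, ContDiff ℝ (⊤ : ℕ∞) f → Function.Periodic f (2 * Real.pi) →
      ∃ B : ℝ, ∀ n : ℕ, (n : ℝ) ^ k *
        ‖∫ θ in (0 : ℝ)..(2 * Real.pi), Complex.exp (n * (θ * Complex.I)) * f θ‖ ≤ B := by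
  induction k with
  | zero =>
    intro f _ _
    refine ⟨∫ θ in (0 : ℝ)..(2 * Real.pi), ‖f θ‖, fun n => ?_⟩
    rw [pow_zero, one_mul]
    refine (intervalIntegral.norm_integral_le_integral_norm Real.two_pi_pos.le).trans_eq ?_
    congr 1
    ext θ
    have h : (n : ℂ) * (θ * Complex.I) = ((n * θ : ℝ) : ℂ) * Complex.I := by push_cast; ring
    rw [norm_mul, h, Complex.norm_exp_ofReal_mul_I, one_mul]
  | succ k ih =>
    intro f hf hper
    have hper' : Function.Periodic (deriv f) (2 * Real.pi) := by
      intro x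
      rw [← deriv_comp_add_const, show (fun y => f (y + 2 * Real.pi)) = f from funext hper]
    obtain ⟨B, hB⟩ := ih (contDiff_infty_iff_deriv.mp hf).2 hper'
    refine ⟨B, fun n => (le_of_eq ?_).trans (hB n)⟩
    rw [integral_exp_mul_deriv_of_periodic (hf.of_le (by exact_mod_cast le_top)) hper, norm_mul,
      norm_neg, norm_mul, Complex.norm_I, Complex.norm_natCast]
    ring

/-- A sequence of polynomial growth times a sequence of fast enough decay is summable. -/
theorem summable_norm_mul_of_growth_of_decay {a b : ℕ → ℂ} {A B : ℝ} {K : ℕ} (hA : 0 ≤ A)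
    (ha : ∀ n : ℕ, ‖a n‖ ≤ A * ((n : ℝ) + 2) ^ K)
    (hb : ∀ n : ℕ, (n : ℝ) ^ (K + 2) * ‖b n‖ ≤ B) : Summable fun n => ‖a n * b n‖ := by
  rw [← summable_nat_add_iff 1]
  have hs : Summable fun n : ℕ => A * 3 ^ K * B * (1 / ((n + 1 : ℕ) : ℝ) ^ 2) :=
    ((summable_nat_add_iff 1).mpr (Real.summable_one_div_nat_pow.mpr one_lt_two)).mul_left _
  refine hs.of_nonneg_of_le (fun _ => norm_nonneg _) fun n => ?_
  have hn : (0 : ℝ) < ((n + 1 : ℕ) : ℝ) := by positivity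
  have h3 : ((n + 1 : ℕ) : ℝ) + 2 ≤ 3 * ((n + 1 : ℕ) : ℝ) := by
    push_cast; linarith [(n.cast_nonneg : (0 : ℝ) ≤ n)]
  have hb' : ((n + 1 : ℕ) : ℝ) ^ K * ‖b (n + 1)‖ ≤ B * (1 / ((n + 1 : ℕ) : ℝ) ^ 2) := by
    rw [mul_one_div, le_div_iff₀ (by positivity)]
    refine (le_of_eq ?_).trans (hb (n + 1))
    ring
  calc ‖a (n + 1) * b (n + 1)‖ = ‖a (n + 1)‖ * ‖b (n + 1)‖ := norm_mul _ _
    _ ≤ A * (((n + 1 : ℕ) : ℝ) + 2) ^ K * ‖b (n + 1)‖ := by gcongr; exact ha _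
    _ ≤ A * (3 * ((n + 1 : ℕ) : ℝ)) ^ K * ‖b (n + 1)‖ := by gcongr
    _ = A * 3 ^ K * (((n + 1 : ℕ) : ℝ) ^ K * ‖b (n + 1)‖) := by rw [mul_pow]; ring
    _ ≤ A * 3 ^ K * (B * (1 / ((n + 1 : ℕ) : ℝ) ^ 2)) := by gcongr
    _ = _ := by ring

/-- The pairing of a power series on a circle with a continuous function, computed termwise. -/
theorem hasSum_integral_circle_mul {a : ℕ → ℂ} {g : ℂ → ℂ}
    (hg : ∀ z ∈ ball (0 : ℂ) 1, HasSum (fun n => a n * z ^ n) (g z))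
    {f : ℝ → ℂ} (hf : Continuous f) {r : ℝ} (hr0 : 0 ≤ r) (hr1 : r < 1) :
    HasSum (fun n : ℕ => a n * r ^ n *
        ∫ θ in (0 : ℝ)..(2 * Real.pi), Complex.exp (n * (θ * Complex.I)) * f θ)
      (∫ θ in (0 : ℝ)..(2 * Real.pi), g (↑r * Complex.exp (↑θ * Complex.I)) * f θ) := by
  have hsum : Summable fun n => ‖a n * (r : ℂ) ^ n‖ :=
    (hg r (by simpa [abs_of_nonneg hr0] using hr1)).summable.norm
  simp_rw [← intervalIntegral.integral_const_mul]
  refine intervalIntegral.hasSum_integral_of_dominated_convergence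
    (fun n θ => ‖a n * (r : ℂ) ^ n‖ * ‖f θ‖) (fun n => ?_) (fun n => ?_) ?_ ?_ ?_
  · exact Continuous.aestronglyMeasurable (by fun_prop)
  · refine Eventually.of_forall fun θ _ => le_of_eq ?_
    have h : (n : ℂ) * (θ * Complex.I) = ((n * θ : ℝ) : ℂ) * Complex.I := by push_cast; ring
    rw [norm_mul, norm_mul (Complex.exp _), h, Complex.norm_exp_ofReal_mul_I, one_mul]
  · exact Eventually.of_forall fun θ _ => hsum.mul_right _
  · simp_rw [tsum_mul_right]
    exact Continuous.intervalIntegrable (by fun_prop) _ _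
  · refine Eventually.of_forall fun θ _ => ?_
    have h := (hg (r * Complex.exp (θ * Complex.I))
      (by simpa [Complex.norm_exp_ofReal_mul_I, abs_of_nonneg hr0] using hr1)).mul_right (f θ)
    refine h.congr_fun fun n => ?_
    rw [mul_pow, Complex.exp_nat_mul]
    ring

/-- **Distributional boundary values on the circle.**
If `g` is holomorphic on the unit disk with `|g(w)| ≤ C (1-|w|)^{-M}`, then for every smooth
`2π`-periodic test function `f` the limit `lim_{r→1⁻} ∫_0^{2π} g(r e^{iθ}) f(θ) dθ`
exists and is finite. -/
theorem disk_boundary_value_exists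
    (C : ℝ) (hC : 0 < C) (M : ℝ) (hM : 0 ≤ M)
    (g : ℂ → ℂ)
    (hg : DifferentiableOn ℂ g (ball (0 : ℂ) 1))
    (hbound : ∀ w ∈ ball (0 : ℂ) 1, ‖g w‖ ≤ C / (1 - ‖w‖) ^ M)
    (f : ℝ → ℂ)
    (hf : ContDiff ℝ (⊤ : ℕ∞) f)
    (hper : ∀ θ : ℝ, f (θ + 2 * Real.pi) = f θ) :
    ∃ Lim : ℂ,
      Tendsto
        (fun r : ℝ => ∫ θ in (0 : ℝ)..(2 * Real.pi),
          g (↑r * Complex.exp (↑θ * Complex.I)) * f θ)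
        (nhdsWithin 1 (Set.Iio 1)) (nhds Lim) := by
  obtain ⟨K, hK⟩ := exists_nat_ge M
  obtain ⟨B, hB⟩ := exists_pow_mul_norm_integral_exp_mul_le (K + 2) hf hper
  have hgs : ∀ z ∈ ball (0 : ℂ) 1,
      HasSum (fun n : ℕ => (n.factorial : ℂ)⁻¹ * iteratedDeriv n g 0 * z ^ n) (g z) := by
    intro z hz
    have h := hasSum_taylorSeries_on_ball hg hz
    simp only [sub_zero, smul_eq_mul] at h
    refine h.congr_fun fun n => ?_
    ring
  have hsum := summable_norm_mul_of_growth_of_decay (by positivity)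
    (norm_taylorCoeff_le_of_polynomial_growth hC.le hK hg hbound) hB
  refine ⟨∑' n : ℕ, (n.factorial : ℂ)⁻¹ * iteratedDeriv n g 0 *
    ∫ θ in (0 : ℝ)..(2 * Real.pi), Complex.exp (n * (θ * Complex.I)) * f θ, ?_⟩
  have hev : ∀ᶠ r : ℝ in nhdsWithin 1 (Set.Iio 1), 0 ≤ r ∧ r < 1 :=
    (eventually_nhdsWithin_of_eventually_nhds (eventually_ge_nhds one_pos)).and
      self_mem_nhdsWithin
  refine Tendsto.congr' (hev.mono fun r hr =>
    (hasSum_integral_circle_mul hgs hf.continuous hr.1 hr.2).tsum_eq) ?_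
  refine tendsto_tsum_of_dominated_convergence hsum (fun n => ?_) (hev.mono fun r hr n => ?_)
  · have hc : Continuous fun r : ℝ => (n.factorial : ℂ)⁻¹ * iteratedDeriv n g 0 * (r : ℂ) ^ n *
        ∫ θ in (0 : ℝ)..(2 * Real.pi), Complex.exp (n * (θ * Complex.I)) * f θ := by fun_prop
    simpa using (hc.tendsto 1).mono_left nhdsWithin_le_nhds
  · rw [mul_right_comm, norm_mul, norm_pow, Complex.norm_real, Real.norm_of_nonneg hr.1]
    exact mul_le_of_le_one_right (norm_nonneg _) (pow_le_one₀ hr.1 hr.2.le)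
end

section
/- Let 𝔻 = {w ∈ ℂ : |w| < 1} and let φ : 𝔻 → ℂ be a holomorphic injective map whose image is contained in 𝔻 \ (-1,0]. Let g be holomorphic on 𝔻 \ (-1,0] and suppose there exist C > 0 and K ≥ 0 with |g(ρ)| ≤ C (1 - |ρ|)^{-K} for all ρ ∈ 𝔻 \ (-1,0]. Then for every smooth 2π-periodic function f : ℝ → ℂ, the limit lim_{r→1⁻} ∫_0^{2π} g(φ(r e^{iθ})) f(θ) dθ exists and is finite. -/
open MeasureTheory Filter Complex Metric

/-- A weak quantitative form of the Schwarz–Pick lemma: a holomorphic self-map of the unit disk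
does not decrease the distance to the boundary by more than a constant factor. -/
theorem one_sub_norm_mul_le_of_mapsTo_unit_ball {φ : ℂ → ℂ}
    (hφ : DifferentiableOn ℂ φ (ball (0 : ℂ) 1))
    (hmaps : Set.MapsTo φ (ball (0 : ℂ) 1) (ball (0 : ℂ) 1)) {w : ℂ} (hw : ‖w‖ < 1) :
    (1 - ‖φ 0‖) / 4 * (1 - ‖w‖) ≤ 1 - ‖φ w‖ := by
  set a := φ 0 with ha
  have ha1 : ‖a‖ < 1 := by simpa using hmaps (mem_ball_self one_pos)
  have hden : ∀ z ∈ ball (0 : ℂ) 1, 1 - ‖a‖ ≤ ‖1 - (starRingEnd ℂ) a * φ z‖ := by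
    intro z hz
    have hz1 : ‖φ z‖ < 1 := by simpa using hmaps hz
    have h := norm_sub_norm_le (1 : ℂ) ((starRingEnd ℂ) a * φ z)
    rw [norm_mul, RCLike.norm_conj, norm_one] at h
    nlinarith [norm_nonneg a, norm_nonneg (φ z)]
  have hden0 : ∀ z ∈ ball (0 : ℂ) 1, 1 - (starRingEnd ℂ) a * φ z ≠ 0 := by
    intro z hz
    rw [← norm_pos_iff]
    linarith [hden z hz]
  have hid : ∀ u : ℂ, ‖1 - (starRingEnd ℂ) a * u‖ ^ 2 - ‖u - a‖ ^ 2
      = (1 - ‖a‖ ^ 2) * (1 - ‖u‖ ^ 2) := by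
    intro u
    simp only [← Complex.normSq_eq_norm_sq, Complex.normSq_apply, sub_re, sub_im, mul_re, mul_im,
      conj_re, conj_im, one_re, one_im]
    ring
  have hdiff : DifferentiableOn ℂ (fun z => (φ z - a) / (1 - (starRingEnd ℂ) a * φ z))
      (ball (0 : ℂ) 1) :=
    (hφ.sub_const a).div ((hφ.const_mul _).const_sub 1) hden0
  have hmaps' : Set.MapsTo (fun z => (φ z - a) / (1 - (starRingEnd ℂ) a * φ z))
      (ball (0 : ℂ) 1) (closedBall (0 : ℂ) 1) := by
    intro z hz
    have hz1 : ‖φ z‖ < 1 := by simpa using hmaps hz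
    rw [mem_closedBall_zero_iff, norm_div]
    refine div_le_one_of_le₀ ?_ (norm_nonneg _)
    refine abs_le_of_sq_le_sq' ?_ (norm_nonneg _) |>.2
    have h1 : 0 ≤ 1 - ‖a‖ ^ 2 := by nlinarith [norm_nonneg a]
    have h2 : 0 ≤ 1 - ‖φ z‖ ^ 2 := by nlinarith [norm_nonneg (φ z)]
    linarith [hid (φ z), mul_nonneg h1 h2]
  have hS := norm_le_norm_of_mapsTo_ball hdiff hmaps' (by simp [ha]) hw
  have hwb : w ∈ ball (0 : ℂ) 1 := by simpa using hw
  have hD := hden w hwb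
  have hDpos : 0 < ‖1 - (starRingEnd ℂ) a * φ w‖ := norm_pos_iff.2 (hden0 w hwb)
  have hu1 : ‖φ w‖ < 1 := by simpa using hmaps hwb
  have hI := hid (φ w)
  rw [norm_div, div_le_iff₀ hDpos] at hS
  have hS2 := pow_le_pow_left₀ (norm_nonneg _) hS 2
  set D := ‖1 - (starRingEnd ℂ) a * φ w‖
  have hw0 := norm_nonneg w
  have ha0 := norm_nonneg a
  have hu0 := norm_nonneg (φ w)
  have h1 : (1 - ‖w‖) * (1 - ‖a‖) ^ 2 ≤ (1 - ‖w‖ ^ 2) * D ^ 2 := by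
    have : (1 - ‖a‖) ^ 2 ≤ D ^ 2 := pow_le_pow_left₀ (by linarith) hD 2
    exact mul_le_mul (by nlinarith) this (sq_nonneg _) (by nlinarith)
  have h2 : (1 + ‖a‖) * (1 - ‖φ w‖ ^ 2) ≤ 4 * (1 - ‖φ w‖) := by
    have : (1 + ‖a‖) * (1 + ‖φ w‖) ≤ 4 := by nlinarith
    nlinarith
  have h3 : (1 - ‖a‖) * ((1 - ‖w‖) * (1 - ‖a‖)) ≤ (1 - ‖a‖) * (4 * (1 - ‖φ w‖)) := by
    have := mul_le_mul_of_nonneg_left h2 (by linarith : 0 ≤ 1 - ‖a‖)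
    nlinarith
  have h4 := le_of_mul_le_mul_left h3 (by linarith)
  linarith

/-- Cauchy estimate: polynomial growth at the boundary of the unit disk forces polynomial growth
of the Taylor coefficients at the origin. -/
theorem norm_taylor_coeff_le_of_polynomial_growth {h : ℂ → ℂ}
    (hh : DifferentiableOn ℂ h (ball (0 : ℂ) 1)) {B : ℝ} (hB : 0 ≤ B) {k : ℕ}
    (hbound : ∀ w ∈ ball (0 : ℂ) 1, ‖h w‖ ≤ B / (1 - ‖w‖) ^ k) (n : ℕ) :
    ‖(n.factorial : ℂ)⁻¹ * iteratedDeriv n h 0‖ ≤ 3 * B * ((n : ℝ) + 2) ^ k := by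
  set R : ℝ := ((n : ℝ) + 1) / (n + 2) with hR
  have hR0 : 0 < R := by positivity
  have hR1 : R < 1 := by rw [hR, div_lt_one (by positivity)]; linarith
  have h1R : 1 - R = ((n : ℝ) + 2)⁻¹ := by rw [hR]; field_simp; ring
  have hsub : closedBall (0 : ℂ) R ⊆ ball 0 1 := closedBall_subset_ball hR1
  have hd : DiffContOnCl ℂ h (ball 0 R) := by
    apply DifferentiableOn.diffContOnCl
    rw [closure_ball _ hR0.ne']
    exact hh.mono hsub
  have hC : ∀ z ∈ sphere (0 : ℂ) R, ‖h z‖ ≤ B * ((n : ℝ) + 2) ^ k := by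
    intro z hz
    have := hbound z (hsub (sphere_subset_closedBall hz))
    rw [mem_sphere_zero_iff_norm.1 hz, h1R, inv_pow, div_inv_eq_mul] at this
    exact this
  have hmain := norm_iteratedDeriv_le_of_forall_mem_sphere_norm_le n hR0 hd hC
  have hRn : (R ^ n)⁻¹ ≤ 3 := by
    have h1 : R⁻¹ ≤ Real.exp ((n + 1 : ℝ)⁻¹) := by
      have := Real.add_one_le_exp ((n + 1 : ℝ)⁻¹)
      refine le_trans (le_of_eq ?_) this
      rw [hR]; field_simp; ring
    calc (R ^ n)⁻¹ = R⁻¹ ^ n := (inv_pow _ _).symm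
      _ ≤ Real.exp ((n + 1 : ℝ)⁻¹) ^ n := pow_le_pow_left₀ (by positivity) h1 n
      _ = Real.exp (n * (n + 1 : ℝ)⁻¹) := (Real.exp_nat_mul _ n).symm
      _ ≤ Real.exp 1 := by
        apply Real.exp_le_exp.2
        rw [← div_eq_mul_inv, div_le_one (by positivity)]
        linarith
      _ ≤ 3 := by linarith [Real.exp_one_lt_d9]
  have hfac : (0 : ℝ) < n.factorial := by exact_mod_cast n.factorial_pos
  rw [norm_mul, norm_inv, Complex.norm_natCast]
  calc (n.factorial : ℝ)⁻¹ * ‖iteratedDeriv n h 0‖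
      ≤ (n.factorial : ℝ)⁻¹ * (n.factorial * (B * ((n : ℝ) + 2) ^ k) / R ^ n) := by gcongr
    _ = (B * ((n : ℝ) + 2) ^ k) * (R ^ n)⁻¹ := by field_simp
    _ ≤ (B * ((n : ℝ) + 2) ^ k) * 3 := by gcongr
    _ = 3 * B * ((n : ℝ) + 2) ^ k := by ring

theorem norm_cexp_natCast_mul_mul_I (n : ℕ) (θ : ℝ) : ‖Complex.exp (n * θ * Complex.I)‖ = 1 := by
  have := Complex.norm_exp_ofReal_mul_I (n * θ)
  push_cast at this
  exact this

theorem natCast_mul_fourier_integral_eq {f : ℝ → ℂ} (hf : ContDiff ℝ (⊤ : ℕ∞) f)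
    (hper : ∀ θ : ℝ, f (θ + 2 * Real.pi) = f θ) (n : ℕ) :
    (n : ℂ) * ∫ θ in (0 : ℝ)..(2 * Real.pi), Complex.exp (n * θ * Complex.I) * f θ
      = Complex.I * ∫ θ in (0 : ℝ)..(2 * Real.pi), Complex.exp (n * θ * Complex.I) * deriv f θ := by
  have hfd : Differentiable ℝ f := hf.differentiable (by simp)
  have hf' : Continuous (deriv f) := hf.continuous_deriv (by simp)
  have hu : ∀ x : ℝ, HasDerivAt (fun θ : ℝ => Complex.exp (n * θ * Complex.I))
      (Complex.exp (n * x * Complex.I) * (n * Complex.I)) x := by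
    intro x
    have h0 : HasDerivAt (fun θ : ℝ => (n : ℂ) * θ * Complex.I) (n * Complex.I) x := by
      simpa using (((hasDerivAt_id (x : ℂ)).const_mul (n : ℂ)).mul_const Complex.I).comp_ofReal
    exact h0.cexp
  have hparts := intervalIntegral.integral_mul_deriv_eq_deriv_mul
    (a := 0) (b := 2 * Real.pi) (fun x _ => hu x) (fun x _ => (hfd x).hasDerivAt)
    (Continuous.intervalIntegrable (by fun_prop) _ _) (hf'.intervalIntegrable _ _)
  have hend : Complex.exp (n * ((2 * Real.pi : ℝ) : ℂ) * Complex.I) = 1 := by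
    rw [Complex.exp_eq_one_iff]
    exact ⟨n, by push_cast; ring⟩
  have hf0 : f (2 * Real.pi) = f 0 := by simpa using hper 0
  rw [hparts, hend, hf0]
  have hpull : ∫ x in (0 : ℝ)..(2 * Real.pi),
      Complex.exp (n * x * Complex.I) * (n * Complex.I) * f x
      = (n * Complex.I) * ∫ x in (0 : ℝ)..(2 * Real.pi), Complex.exp (n * x * Complex.I) * f x := by
    rw [← intervalIntegral.integral_const_mul]
    congr 1
    ext x
    ring
  rw [hpull]
  simp only [ofReal_zero, mul_zero, zero_mul, Complex.exp_zero]
  linear_combination ((n : ℂ) * ∫ x in (0 : ℝ)..(2 * Real.pi),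
    Complex.exp (n * x * Complex.I) * f x) * Complex.I_mul_I

/-- The Fourier coefficients of a smooth periodic function decay rapidly. -/
theorem exists_pow_mul_norm_fourier_integral_le (m : ℕ) : ∀ f : ℝ → ℂ,
    ContDiff ℝ (⊤ : ℕ∞) f → (∀ θ : ℝ, f (θ + 2 * Real.pi) = f θ) →
    ∃ M : ℝ, ∀ n : ℕ, ((n : ℝ) + 2) ^ m *
      ‖∫ θ in (0 : ℝ)..(2 * Real.pi), Complex.exp (n * θ * Complex.I) * f θ‖ ≤ M := by
  induction m with
  | zero =>
    intro f hf _
    obtain ⟨M, hM⟩ := (isCompact_uIcc (a := (0 : ℝ)) (b := 2 * Real.pi)).exists_bound_of_continuousOn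
      hf.continuous.continuousOn
    refine ⟨M * |2 * Real.pi - 0|, fun n => ?_⟩
    rw [pow_zero, one_mul]
    refine intervalIntegral.norm_integral_le_of_norm_le_const fun x hx => ?_
    rw [norm_mul, norm_cexp_natCast_mul_mul_I, one_mul]
    exact hM x (Set.uIoc_subset_uIcc hx)
  | succ m ih =>
    intro f hf hper
    have hf' : ContDiff ℝ (⊤ : ℕ∞) (deriv f) := by
      exact (contDiff_infty_iff_deriv.1 hf).2
    have hper' : ∀ θ : ℝ, deriv f (θ + 2 * Real.pi) = deriv f θ := by
      intro θ
      rw [← deriv_comp_add_const, funext hper]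
    obtain ⟨M₁, hM₁⟩ := ih f hf hper
    obtain ⟨M₂, hM₂⟩ := ih (deriv f) hf' hper'
    refine ⟨M₂ + 2 * M₁, fun n => ?_⟩
    have key := congrArg norm (natCast_mul_fourier_integral_eq hf hper n)
    rw [norm_mul, norm_mul, Complex.norm_I, one_mul, Complex.norm_natCast] at key
    have h1 := hM₁ n
    have h2 := hM₂ n
    rw [← key] at h2
    rw [pow_succ]
    linarith

/-- A holomorphic function of polynomial growth on the unit disk has a distributional boundary
value. -/
theorem exists_tendsto_boundary_pairing {h : ℂ → ℂ}
    (hh : DifferentiableOn ℂ h (ball (0 : ℂ) 1)) {B : ℝ} (hB : 0 ≤ B) {k : ℕ}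
    (hbound : ∀ w ∈ ball (0 : ℂ) 1, ‖h w‖ ≤ B / (1 - ‖w‖) ^ k)
    {f : ℝ → ℂ} (hf : ContDiff ℝ (⊤ : ℕ∞) f) (hper : ∀ θ : ℝ, f (θ + 2 * Real.pi) = f θ) :
    ∃ L : ℂ, Tendsto (fun r : ℝ => ∫ θ in (0 : ℝ)..(2 * Real.pi),
      h (↑r * Complex.exp (↑θ * Complex.I)) * f θ) (nhdsWithin 1 (Set.Iio 1)) (nhds L) := by
  set a : ℕ → ℂ := fun n => (n.factorial : ℂ)⁻¹ * iteratedDeriv n h 0 with ha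
  set c : ℕ → ℂ := fun n =>
    ∫ θ in (0 : ℝ)..(2 * Real.pi), Complex.exp (n * θ * Complex.I) * f θ with hc
  have hpow : ∀ w ∈ ball (0 : ℂ) 1, HasSum (fun n => a n * w ^ n) (h w) := by
    intro w hw
    have hterm : (fun n => a n * w ^ n) = fun n : ℕ =>
        (n.factorial : ℂ)⁻¹ • (w - 0) ^ n • iteratedDeriv n h 0 := by
      ext n
      simp only [ha, sub_zero, smul_eq_mul]
      ring
    rw [hterm]
    exact Complex.hasSum_taylorSeries_on_ball hh hw
  obtain ⟨M, hM⟩ := exists_pow_mul_norm_fourier_integral_le (k + 2) f hf hper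
  have hac : ∀ n, ‖a n * c n‖ ≤ 3 * B * M * (1 / ((n : ℝ) + 2) ^ 2) := by
    intro n
    have h1 := norm_taylor_coeff_le_of_polynomial_growth hh hB hbound n
    have h2 := hM n
    rw [pow_add] at h2
    rw [norm_mul, mul_one_div, le_div_iff₀ (by positivity)]
    calc ‖a n‖ * ‖c n‖ * ((n : ℝ) + 2) ^ 2
        ≤ (3 * B * ((n : ℝ) + 2) ^ k) * ‖c n‖ * ((n : ℝ) + 2) ^ 2 := by gcongr
      _ = 3 * B * (((n : ℝ) + 2) ^ k * ((n : ℝ) + 2) ^ 2 * ‖c n‖) := by ring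
      _ ≤ 3 * B * M := by gcongr
  have hsum : Summable fun n : ℕ => 3 * B * M * (1 / ((n : ℝ) + 2) ^ 2) := by
    have := (summable_nat_add_iff 2).2 (Real.summable_one_div_nat_pow.2 one_lt_two)
    push_cast at this
    exact this.mul_left _
  obtain ⟨M₀, hM₀⟩ := (isCompact_uIcc (a := (0 : ℝ)) (b := 2 * Real.pi)).exists_bound_of_continuousOn
    hf.continuous.continuousOn
  have hseries : ∀ r ∈ Set.Ioo (0 : ℝ) 1, ∫ θ in (0 : ℝ)..(2 * Real.pi),
      h (↑r * Complex.exp (↑θ * Complex.I)) * f θ = ∑' n, (r : ℂ) ^ n * (a n * c n) := by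
    rintro r ⟨hr0, hr1⟩
    have hsr : Summable fun n => ‖a n‖ * r ^ n * M₀ := by
      have := (hpow (r : ℂ) (by simpa [abs_of_pos hr0] using hr1)).summable.norm
      simp only [norm_mul, norm_pow, Complex.norm_real, Real.norm_eq_abs, abs_of_pos hr0] at this
      exact this.mul_right _
    have hfc := hf.continuous
    have hnorm : ∀ θ : ℝ, ‖(r : ℂ) * Complex.exp (θ * Complex.I)‖ = r := by
      intro θ
      rw [norm_mul, Complex.norm_exp_ofReal_mul_I, mul_one, Complex.norm_real, Real.norm_eq_abs,
        abs_of_pos hr0]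
    have := intervalIntegral.hasSum_integral_of_dominated_convergence (μ := volume)
      (a := 0) (b := 2 * Real.pi)
      (F := fun n θ => a n * (↑r * Complex.exp (↑θ * Complex.I)) ^ n * f θ)
      (f := fun θ => h (↑r * Complex.exp (↑θ * Complex.I)) * f θ)
      (fun n _ => ‖a n‖ * r ^ n * M₀)
      (fun n => Continuous.aestronglyMeasurable (by fun_prop))
      (fun n => ae_of_all _ fun θ hθ => by
        have hfθ := hM₀ θ (Set.uIoc_subset_uIcc hθ)
        rw [norm_mul, norm_mul (a n), norm_pow, hnorm]
        gcongr)
      (ae_of_all _ fun θ _ => hsr)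
      intervalIntegrable_const
      (ae_of_all _ fun θ _ => by
        refine (hpow _ ?_).mul_right _
        rw [mem_ball_zero_iff, hnorm]
        exact hr1)
    rw [← this.tsum_eq]
    congr 1
    ext n
    rw [hc, ← mul_assoc, ← intervalIntegral.integral_const_mul]
    congr 1
    ext θ
    rw [mul_pow, ← Complex.exp_nat_mul, mul_assoc (n : ℂ)]
    ring
  refine ⟨∑' n, a n * c n, ?_⟩
  have hlim : Tendsto (fun r : ℝ => ∑' n, (r : ℂ) ^ n * (a n * c n))
      (nhdsWithin 1 (Set.Iio 1)) (nhds (∑' n, a n * c n)) := by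
    refine tendsto_tsum_of_dominated_convergence hsum (fun n => ?_) ?_
    · have hcont : Continuous fun r : ℝ => (r : ℂ) ^ n * (a n * c n) := by fun_prop
      have := (hcont.tendsto 1).mono_left (nhdsWithin_le_nhds (s := Set.Iio 1))
      simpa using this
    · filter_upwards [Ioo_mem_nhdsLT (zero_lt_one (α := ℝ))] with r hr n
      rw [norm_mul, norm_pow, Complex.norm_real, Real.norm_eq_abs, abs_of_pos hr.1]
      exact (mul_le_of_le_one_left (norm_nonneg _) (pow_le_one₀ hr.1.le hr.2.le)).trans (hac n)
  refine hlim.congr' ?_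
  filter_upwards [Ioo_mem_nhdsLT (zero_lt_one (α := ℝ))] with r hr
  exact (hseries r hr).symm

/-- **Theorem on restricted boundaries (pulled-back boundary values).**
If `φ : 𝔻 → 𝔻 \ (-1,0]` is holomorphic injective, and `g` is holomorphic on the cut disk
with `|g(ρ)| ≤ C (1-|ρ|)^{-K}`, then for every smooth `2π`-periodic test function `f`
the limit `lim_{r→1⁻} ∫_0^{2π} g(φ(r e^{iθ})) f(θ) dθ` exists and is finite. -/
theorem pulled_back_boundary_value_exists
    (φ : ℂ → ℂ)
    (hφ : DifferentiableOn ℂ φ (ball (0 : ℂ) 1))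
    (hinj : Set.InjOn φ (ball (0 : ℂ) 1))
    (himg : ∀ w ∈ ball (0 : ℂ) 1,
      φ w ∈ ball (0 : ℂ) 1 \ (Complex.ofReal '' Set.Ioc (-1 : ℝ) 0))
    (g : ℂ → ℂ)
    (hg : DifferentiableOn ℂ g
      (ball (0 : ℂ) 1 \ (Complex.ofReal '' Set.Ioc (-1 : ℝ) 0)))
    (C : ℝ) (hC : 0 < C) (K : ℝ) (hK : 0 ≤ K)
    (hbound : ∀ ρ ∈ ball (0 : ℂ) 1 \ (Complex.ofReal '' Set.Ioc (-1 : ℝ) 0),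
      ‖g ρ‖ ≤ C / (1 - ‖ρ‖) ^ K)
    (f : ℝ → ℂ)
    (hf : ContDiff ℝ (⊤ : ℕ∞) f)
    (hper : ∀ θ : ℝ, f (θ + 2 * Real.pi) = f θ) :
    ∃ Lim : ℂ,
      Tendsto
        (fun r : ℝ => ∫ θ in (0 : ℝ)..(2 * Real.pi),
          g (φ (↑r * Complex.exp (↑θ * Complex.I))) * f θ)
        (nhdsWithin 1 (Set.Iio 1)) (nhds Lim) := by
  have hmaps : Set.MapsTo φ (ball (0 : ℂ) 1) (ball (0 : ℂ) 1) := fun w hw => (himg w hw).1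
  have ha1 : ‖φ 0‖ < 1 := by simpa using hmaps (mem_ball_self one_pos)
  set d : ℝ := (1 - ‖φ 0‖) / 4 with hd
  have hd0 : 0 < d := by rw [hd]; linarith
  refine exists_tendsto_boundary_pairing (h := fun w => g (φ w)) (B := C / d ^ ⌈K⌉₊)
    (k := ⌈K⌉₊) (hg.comp hφ himg) (by positivity) (fun w hw => ?_) hf hper
  have hw1 : ‖w‖ < 1 := by simpa using hw
  have hu1 : ‖φ w‖ < 1 := by simpa using hmaps hw
  have hpick := one_sub_norm_mul_le_of_mapsTo_unit_ball hφ hmaps hw1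
  have hpos : 0 < d * (1 - ‖w‖) := mul_pos hd0 (by linarith)
  refine (hbound _ (himg w hw)).trans ?_
  rw [div_div, ← mul_pow]
  refine div_le_div_of_nonneg_left hC.le (by positivity) ?_
  calc (d * (1 - ‖w‖)) ^ ⌈K⌉₊ ≤ (1 - ‖φ w‖) ^ ⌈K⌉₊ := pow_le_pow_left₀ hpos.le hpick _
    _ = (1 - ‖φ w‖) ^ (⌈K⌉₊ : ℝ) := (Real.rpow_natCast _ _).symm
    _ ≤ (1 - ‖φ w‖) ^ K := Real.rpow_le_rpow_of_exponent_ge (by linarith)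
        (by linarith [norm_nonneg (φ w)]) (Nat.le_ceil K)
end
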